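/- arXiv:cs/0102007 — 2 statements merged into one kernel-verified Lean document; each statement's English description precedes it below -/
import Mathlib

section
/- Let φ be a CNF formula over variables x₁,…,x_n with n ≥ 2 and clauses C₁,…,C_m (m ≥ 1), each clause regarded as the set of its literals. Then φ is satisfiable if and only if the graph G_φ satisfies the sequence ℳ_φ, i.e., if and only if G_φ has a plane embedding in which, for each j ∈ {1,…,m}, some face has on its boundary the vertex c_j and at least one literal vertex of the clause C_j. -/
open Set Topology

/-- A plane embedding of a simple graph `G`: an injective placement of the vertices in the
plane together with, for each edge, an arc (the image of an injective continuous path) whose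
endpoints are the images of the endpoints of the edge, such that two distinct arcs intersect
only in images of common endpoints and an arc meets the image of a vertex only if that vertex
is an endpoint of the corresponding edge. -/
structure PlaneEmbedding {V : Type*} (G : SimpleGraph V) where
  vmap : V → ℝ × ℝ
  vmap_inj : Function.Injective vmap
  arc : G.edgeSet → Set (ℝ × ℝ)
  arc_path : ∀ e : G.edgeSet, ∃ f : unitInterval → ℝ × ℝ,
    Continuous f ∧ Function.Injective f ∧ Set.range f = arc e ∧
    ∃ u v : V, (e : Sym2 V) = s(u, v) ∧ f 0 = vmap u ∧ f 1 = vmap v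
  arc_inter : ∀ e e' : G.edgeSet, e ≠ e' →
    arc e ∩ arc e' ⊆ vmap '' {x : V | x ∈ (e : Sym2 V) ∧ x ∈ (e' : Sym2 V)}
  vmap_mem_arc : ∀ (e : G.edgeSet) (x : V), vmap x ∈ arc e → x ∈ (e : Sym2 V)

namespace PlaneEmbedding

variable {V : Type*} {G : SimpleGraph V}

/-- The union of all arcs of the embedding. -/
def drawing (Φ : PlaneEmbedding G) : Set (ℝ × ℝ) :=
  ⋃ e : G.edgeSet, Φ.arc e

/-- The faces of the embedding: connected components of the complement of the drawing. -/
def IsFace (Φ : PlaneEmbedding G) (F : Set (ℝ × ℝ)) : Prop :=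
  ∃ p ∈ Φ.drawingᶜ, F = connectedComponentIn Φ.drawingᶜ p

/-- The vertex `v` lies on the boundary of the face `F`. -/
def OnFace (Φ : PlaneEmbedding G) (F : Set (ℝ × ℝ)) (v : V) : Prop :=
  Φ.vmap v ∈ frontier F

/-- The embedding satisfies a family `C` of vertex subsets: some face has on its boundary
at least one vertex from each set in `C`. -/
def SatisfiesFam (Φ : PlaneEmbedding G) (C : Set (Set V)) : Prop :=
  ∃ F : Set (ℝ × ℝ), Φ.IsFace F ∧ ∀ U ∈ C, ∃ v ∈ U, Φ.OnFace F v

end PlaneEmbedding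

/-- A graph is planar if it has a plane embedding. -/
def Planar {V : Type*} (G : SimpleGraph V) : Prop :=
  Nonempty (PlaneEmbedding G)
/-- Vertices of the graph `G_φ`: literal vertices `x_i` (`lit i true`) and `x̄_i`
(`lit i false`), clause vertices `c_j`, and the vertices `u_0, …, u_n`. -/
inductive CNFVtx (n m : ℕ) : Type where
  | lit : Fin n → Bool → CNFVtx n m
  | cl  : Fin m → CNFVtx n m
  | u   : Fin (n + 1) → CNFVtx n m

/-- The base edge relation of `G_φ`. -/
def cnfRel (n m : ℕ) : CNFVtx n m → CNFVtx n m → Prop := fun a b =>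
  (∃ (i : Fin n) (p : Bool), a = CNFVtx.u i.castSucc ∧ b = CNFVtx.lit i p) ∨
  (∃ (i : Fin n) (p : Bool), a = CNFVtx.lit i p ∧ b = CNFVtx.u i.succ) ∨
  (∃ j : Fin m, (j : ℕ) = 0 ∧ a = CNFVtx.u 0 ∧ b = CNFVtx.cl j) ∨
  (∃ j j' : Fin m, (j' : ℕ) = (j : ℕ) + 1 ∧ a = CNFVtx.cl j ∧ b = CNFVtx.cl j') ∨
  (∃ j : Fin m, (j : ℕ) + 1 = m ∧ a = CNFVtx.cl j ∧ b = CNFVtx.u (Fin.last n)) ∨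
  (a = CNFVtx.u (Fin.last n) ∧ b = CNFVtx.u 0)

/-- The simple graph `G_φ` associated with a CNF formula with `n` variables and `m` clauses. -/
def cnfGraph (n m : ℕ) : SimpleGraph (CNFVtx n m) :=
  SimpleGraph.fromRel (cnfRel n m)


namespace PlaneK33

theorem exists_log_sq (F : ℝ × ℝ → ℂ) (hF : Continuous F) (h0 : ∀ x, F x ≠ 0) :
    ∃ L : ℝ × ℝ → ℂ, Continuous L ∧ ∀ x, Complex.exp (L x) = F x := by
  obtain ⟨L, ⟨-, hL⟩, -⟩ := Complex.isCoveringMapOn_exp.existsUnique_continuousMap_lifts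
    ⟨F, hF⟩ (a₀ := (0, 0)) (e₀ := Complex.log (F (0, 0))) (Complex.exp_log (h0 _))
    (fun x => h0 x)
  exact ⟨L, L.continuous, fun x => congrFun hL x⟩

/-- Two lifts of proportional paths have the same increment. -/
theorem incr_eq (f g : ℝ → ℂ) (hf : Continuous f) (hg : Continuous g) (c : ℂ)
    (h : ∀ s, Complex.exp (f s) = c * Complex.exp (g s)) : f 1 - f 0 = g 1 - g 0 := by
  have h1 : ∀ s, ∃ k : ℤ, (f s - g s) - (f 0 - g 0) = k * (2 * Real.pi * Complex.I) := by
    intro s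
    have : Complex.exp ((f s - g s) - (f 0 - g 0)) = 1 := by
      have hc : c ≠ 0 := by
        rintro rfl
        have := h 0
        simp at this
      rw [Complex.exp_sub, Complex.exp_sub, Complex.exp_sub, h s, h 0]
      have e1 := Complex.exp_ne_zero (g s)
      have e2 := Complex.exp_ne_zero (g 0)
      field_simp
    exact Complex.exp_eq_one_iff.1 this
  choose k hk using h1
  have hcont : Continuous fun s => (k s : ℝ) := by
    have : (fun s => (k s : ℝ)) = fun s => ((f s - g s) - (f 0 - g 0)).im / (2 * Real.pi) := by
      funext s
      rw [hk s]
      have := Real.pi_pos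
      simp
    rw [this]
    fun_prop
  have hk' : Continuous k := by
    have := Int.isClosedEmbedding_coe_real.isInducing
    exact this.continuous_iff.2 hcont
  have hkc : k 1 = k 0 := PreconnectedSpace.constant inferInstance hk'
  have a := hk 1
  have b := hk 0
  rw [hkc, ← b] at a
  linear_combination a

open Classical in
/-- The increment of the complex logarithm along a path. -/
noncomputable def chg (f : ℝ → ℂ) : ℂ :=
  if h : ∃ L : ℝ → ℂ, Continuous L ∧ ∀ s, Complex.exp (L s) = f s then
    h.choose 1 - h.choose 0 else 0

theorem chg_eq {f g : ℝ → ℂ} {c : ℂ} (hg : Continuous g)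
    (h : ∀ s, Complex.exp (g s) = c * f s) : chg f = g 1 - g 0 := by
  have hc : c ≠ 0 := by
    rintro rfl
    have := h 0
    simp at this
  have hex : ∃ L : ℝ → ℂ, Continuous L ∧ ∀ s, Complex.exp (L s) = f s := by
    refine ⟨fun s => g s - Complex.log c, by fun_prop, fun s => ?_⟩
    rw [Complex.exp_sub, h s, Complex.exp_log hc]
    field_simp
  rw [chg, dif_pos hex]
  refine (incr_eq _ _ hg hex.choose_spec.1 c fun s => ?_).symm
  rw [h s, hex.choose_spec.2 s]

theorem chg_sq (γ δ : ℝ → ℂ) (hγ : Continuous γ) (hδ : Continuous δ)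
    (h : ∀ s t, γ s ≠ δ t) :
    chg (fun s => γ s - δ 0) + chg (fun t => δ t - γ 1) =
      chg (fun t => δ t - γ 0) + chg (fun s => γ s - δ 1) := by
  obtain ⟨L, hL, hexp⟩ := exists_log_sq (fun x => γ x.1 - δ x.2) (by fun_prop)
    (fun x => sub_ne_zero.2 (h _ _))
  rw [chg_eq (g := fun s => L (s, 0)) (c := 1) (by fun_prop) (by simp [hexp]),
    chg_eq (g := fun s => L (1, s)) (c := -1) (by fun_prop) (by simp [hexp]),
    chg_eq (g := fun s => L (0, s)) (c := -1) (by fun_prop) (by simp [hexp]),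
    chg_eq (g := fun s => L (s, 1)) (c := 1) (by fun_prop) (by simp [hexp])]
  ring

theorem exp_chg (f : ℝ → ℂ) (hf : Continuous f) (h : ∀ s, f s ≠ 0) :
    Complex.exp (chg f) = f 1 / f 0 := by
  obtain ⟨L, hL, hexp⟩ := exists_log_sq (fun x => f x.1) (by fun_prop) (fun x => h _)
  rw [chg_eq (g := fun s => L (s, 0)) (c := 1) (by fun_prop) (by simp [hexp]), Complex.exp_sub,
    hexp, hexp]

theorem exists_logs (a : Fin 3 → ℂ) (h : ∀ i i', i ≠ i' → a i ≠ a i') :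
    ∃ α : Fin 3 → Fin 3 → ℂ, (∀ i i', i ≠ i' → Complex.exp (α i i') = a i - a i') ∧
      ∀ i i', i < i' → α i' i = α i i' + Real.pi * Complex.I := by
  refine ⟨fun i i' => if i < i' then Complex.log (a i - a i') else
    Complex.log (a i' - a i) + Real.pi * Complex.I, ?_, ?_⟩
  · intro i i' hi
    dsimp only
    split_ifs
    · exact Complex.exp_log (sub_ne_zero.2 (h _ _ hi))
    · rw [Complex.exp_add, Complex.exp_log (sub_ne_zero.2 (h _ _ hi.symm)), Complex.exp_pi_mul_I]
      ring
  · intro i i' hi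
    simp [hi, not_lt.2 hi.le]

theorem k33_paths (a b : Fin 3 → ℂ) (γ : Fin 3 → Fin 3 → ℝ → ℂ)
    (hc : ∀ i j, Continuous (γ i j)) (h0 : ∀ i j, γ i j 0 = a i) (h1 : ∀ i j, γ i j 1 = b j)
    (hd : ∀ i j i' j', i ≠ i' → j ≠ j' → ∀ s t, γ i j s ≠ γ i' j' t) : False := by
  have hex : ∀ j : Fin 3, ∃ j', j ≠ j' := by decide
  have haγ : ∀ i j i', i ≠ i' → ∀ s, γ i j s ≠ a i' := by
    intro i j i' hi s
    obtain ⟨j', hj⟩ := hex j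
    rw [← h0 i' j']
    exact hd _ _ _ _ hi hj _ _
  have hbγ : ∀ i j j', j ≠ j' → ∀ s, γ i j s ≠ b j' := by
    intro i j j' hj s
    obtain ⟨i', hi⟩ := hex i
    rw [← h1 i' j']
    exact hd _ _ _ _ hi hj _ _
  have ha : ∀ i i', i ≠ i' → a i ≠ a i' := by
    intro i i' hi
    have := haγ i 0 i' hi 0
    rwa [h0] at this
  have hb : ∀ i i', i ≠ i' → b i ≠ b i' := by
    intro i i' hi
    have := hbγ 0 i i' hi 1
    rwa [h1] at this
  have hab : ∀ i j, b j ≠ a i := by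
    intro i j
    obtain ⟨i', hi⟩ := hex i
    have := haγ i' j i hi.symm 1
    rwa [h1] at this
  obtain ⟨α, hα, hα'⟩ := exists_logs a ha
  obtain ⟨β, hβ, hβ'⟩ := exists_logs b hb
  have hk1 : ∀ i j i', ∃ k : ℤ, i ≠ i' → chg (fun s => γ i j s - a i') =
      Complex.log (b j - a i') - α i i' + k * (2 * Real.pi * Complex.I) := by
    intro i j i'
    by_cases hi : i = i'
    · exact ⟨0, fun h => absurd hi h⟩
    have : Complex.exp (chg (fun s => γ i j s - a i')) =
        Complex.exp (Complex.log (b j - a i') - α i i') := by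
      rw [exp_chg _ (by have := hc i j; fun_prop) fun s => sub_ne_zero.2 (haγ i j i' hi s),
        Complex.exp_sub, hα _ _ hi, Complex.exp_log (sub_ne_zero.2 (hab _ _)), h0, h1]
    obtain ⟨k, hk⟩ := Complex.exp_eq_exp_iff_exists_int.1 this
    exact ⟨k, fun _ => hk⟩
  have hk2 : ∀ i j j', ∃ k : ℤ, j ≠ j' → chg (fun s => γ i j s - b j') =
      β j j' - Complex.log (b j' - a i) + Real.pi * Complex.I
        + k * (2 * Real.pi * Complex.I) := by
    intro i j j'
    by_cases hj : j = j'
    · exact ⟨0, fun h => absurd hj h⟩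
    have : Complex.exp (chg (fun s => γ i j s - b j')) =
        Complex.exp (β j j' - Complex.log (b j' - a i) + Real.pi * Complex.I) := by
      rw [exp_chg _ (by have := hc i j; fun_prop) fun s => sub_ne_zero.2 (hbγ i j j' hj s),
        Complex.exp_add, Complex.exp_sub, hβ _ _ hj, Complex.exp_log (sub_ne_zero.2 (hab _ _)),
        h0, h1, Complex.exp_pi_mul_I, ← neg_sub (b j') (a i), div_neg]
      ring
    obtain ⟨k, hk⟩ := Complex.exp_eq_exp_iff_exists_int.1 this
    exact ⟨k, fun _ => hk⟩
  choose k1 hk1 using hk1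
  choose k2 hk2 using hk2
  have hpi : (Real.pi : ℂ) * Complex.I ≠ 0 := by simp [Real.pi_ne_zero]
  have key : ∀ i j i' j', i < i' → j ≠ j' →
      k1 i' j' i + k2 i j j' - k1 i j i' - k2 i' j' j = if j < j' then 1 else 0 := by
    intro i j i' j' hi hj
    have e := chg_sq (γ i j) (γ i' j') (hc _ _) (hc _ _) (hd _ _ _ _ hi.ne hj)
    rw [h0, h1, h0, h1, hk1 _ _ _ hi.ne, hk1 _ _ _ hi.ne', hk2 _ _ _ hj, hk2 _ _ _ hj.symm,
      hα' _ _ hi] at e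
    have e2 : (Real.pi * Complex.I) * (((k1 i' j' i + k2 i j j' - k1 i j i' - k2 i' j' j : ℤ) : ℂ))
        = (Real.pi * Complex.I) * ((if j < j' then 1 else 0 : ℤ) : ℂ) := by
      rcases lt_or_gt_of_ne hj with h | h
      · rw [hβ' _ _ h] at e
        rw [if_pos h]
        push_cast
        linear_combination -e / 2
      · rw [hβ' _ _ h] at e
        rw [if_neg h.not_gt]
        push_cast
        linear_combination -e / 2
    exact_mod_cast mul_left_cancel₀ hpi e2
  have K := fun i j i' j' h h' => key i j i' j' h h'
  have q1 := key 0 0 1 1 (by decide) (by decide)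
  have q2 := key 0 0 1 2 (by decide) (by decide)
  have q3 := key 0 1 1 0 (by decide) (by decide)
  have q4 := key 0 1 1 2 (by decide) (by decide)
  have q5 := key 0 2 1 0 (by decide) (by decide)
  have q6 := key 0 2 1 1 (by decide) (by decide)
  have r1 := key 0 0 2 1 (by decide) (by decide)
  have r2 := key 0 0 2 2 (by decide) (by decide)
  have r3 := key 0 1 2 0 (by decide) (by decide)
  have r4 := key 0 1 2 2 (by decide) (by decide)
  have r5 := key 0 2 2 0 (by decide) (by decide)
  have r6 := key 0 2 2 1 (by decide) (by decide)
  have s1 := key 1 0 2 1 (by decide) (by decide)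
  have s2 := key 1 0 2 2 (by decide) (by decide)
  have s3 := key 1 1 2 0 (by decide) (by decide)
  have s4 := key 1 1 2 2 (by decide) (by decide)
  have s5 := key 1 2 2 0 (by decide) (by decide)
  have s6 := key 1 2 2 1 (by decide) (by decide)
  simp at q1 q2 q3 q4 q5 q6 r1 r2 r3 r4 r5 r6 s1 s2 s3 s4 s5 s6
  omega

/-- Nonplanarity of `K_{3,3}` in a set-theoretic form. -/
theorem k33_sets (a b : Fin 3 → ℝ × ℝ) (S : Fin 3 → Fin 3 → Set (ℝ × ℝ))
    (hj : ∀ i j, JoinedIn (S i j) (a i) (b j))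
    (hd : ∀ i j i' j', i ≠ i' → j ≠ j' → Disjoint (S i j) (S i' j')) : False := by
  let φ : ℝ × ℝ → ℂ := Complex.equivRealProdCLM.symm
  have hφ : Continuous φ := Complex.equivRealProdCLM.symm.continuous
  have hφi : Function.Injective φ := Complex.equivRealProdCLM.symm.injective
  refine k33_paths (fun i => φ (a i)) (fun i => φ (b i))
    (fun i j t => φ ((hj i j).somePath.extend t)) ?_ ?_ ?_ ?_
  · intro i j
    exact hφ.comp (Path.continuous_extend _)
  · intro i j
    simp
  · intro i j
    simp
  · intro i j i' j' hi hj' s t hst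
    have hst := hφi hst
    have e1 : (hj i j).somePath.extend s ∈ S i j := (hj i j).somePath_mem _
    have e2 : (hj i' j').somePath.extend t ∈ S i' j' := (hj i' j').somePath_mem _
    rw [hst] at e1
    exact Set.disjoint_left.1 (hd _ _ _ _ hi hj') e1 e2

end PlaneK33

namespace PlaneEmbedding

/-- The part of the drawing spanned by a vertex set. -/
def region {V : Type*} {G : SimpleGraph V} (Φ : PlaneEmbedding G) (X : Set V) : Set (ℝ × ℝ) :=
  Φ.vmap '' X ∪ ⋃ e : {e : G.edgeSet // ∀ v ∈ (e : Sym2 V), v ∈ X}, Φ.arc e.1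

section region
variable {V : Type*} {G : SimpleGraph V} (Φ : PlaneEmbedding G)

theorem mem_region {X : Set V} {q : ℝ × ℝ} : q ∈ Φ.region X ↔
    (∃ v ∈ X, Φ.vmap v = q) ∨ ∃ e : G.edgeSet, (∀ v ∈ (e : Sym2 V), v ∈ X) ∧ q ∈ Φ.arc e := by
  simp [region]

theorem vmap_mem_region {X : Set V} {v : V} : Φ.vmap v ∈ Φ.region X ↔ v ∈ X := by
  rw [mem_region]
  constructor
  · rintro (⟨w, hw, h⟩ | ⟨e, he, h⟩)
    · rwa [← Φ.vmap_inj h]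
    · exact he _ (Φ.vmap_mem_arc _ _ h)
  · exact fun h => Or.inl ⟨v, h, rfl⟩

theorem region_disjoint {X Y : Set V} (h : Disjoint X Y) :
    Disjoint (Φ.region X) (Φ.region Y) := by
  rw [Set.disjoint_left] at h ⊢
  intro q hX hY
  rcases Φ.mem_region.1 hX with ⟨v, hv, rfl⟩ | ⟨e, he, hq⟩
  · exact h hv (Φ.vmap_mem_region.1 hY)
  rcases Φ.mem_region.1 hY with ⟨v, hv, rfl⟩ | ⟨e', he', hq'⟩
  · exact h (Φ.vmap_mem_region.1 hX) hv
  by_cases hee : e = e'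
  · subst hee
    obtain ⟨⟨a, b⟩, hab⟩ := e
    exact h (he a (Sym2.mem_mk_left _ _)) (he' a (Sym2.mem_mk_left _ _))
  · obtain ⟨v, hv, -⟩ := Φ.arc_inter e e' hee ⟨hq, hq'⟩
    exact h (he _ hv.1) (he' _ hv.2)

theorem isCompact_arc (e : G.edgeSet) : IsCompact (Φ.arc e) := by
  obtain ⟨f, hf, -, hr, -⟩ := Φ.arc_path e
  rw [← hr]
  exact isCompact_range hf

theorem isClosed_region [Finite V] (X : Set V) : IsClosed (Φ.region X) := by
  refine IsClosed.union ((Set.toFinite X).image _).isClosed ?_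
  exact isClosed_iUnion_of_finite fun _ => (Φ.isCompact_arc _).isClosed

theorem isClosed_drawing [Finite V] : IsClosed Φ.drawing :=
  isClosed_iUnion_of_finite fun _ => (Φ.isCompact_arc _).isClosed

theorem joined_of_adj {X : Set V} {a b : V} (hab : G.Adj a b) (ha : a ∈ X) (hb : b ∈ X) :
    JoinedIn (Φ.region X) (Φ.vmap a) (Φ.vmap b) := by
  obtain ⟨f, hf, -, hr, u, v, huv, h0, h1⟩ := Φ.arc_path ⟨s(a, b), hab⟩
  have key : JoinedIn (Φ.region X) (Φ.vmap u) (Φ.vmap v) := by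
    refine ⟨⟨⟨f, hf⟩, h0, h1⟩, fun t => ?_⟩
    refine Φ.mem_region.2 (Or.inr ⟨⟨s(a, b), hab⟩, ?_, ?_⟩)
    · intro w hw
      rcases Sym2.mem_iff.1 hw with rfl | rfl <;> assumption
    · rw [← hr]
      exact ⟨t, rfl⟩
  rcases Sym2.eq_iff.1 huv with ⟨rfl, rfl⟩ | ⟨rfl, rfl⟩
  · exact key
  · exact key.symm

theorem region_subset_drawing (hcov : ∀ v, Φ.vmap v ∈ Φ.drawing) (X : Set V) :
    Φ.region X ⊆ Φ.drawing := by
  intro q hq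
  rcases Φ.mem_region.1 hq with ⟨v, -, rfl⟩ | ⟨e, -, hq⟩
  · exact hcov v
  · exact Set.mem_iUnion.2 ⟨e, hq⟩

theorem vmap_mem_drawing {a b : V} (h : G.Adj a b) : Φ.vmap a ∈ Φ.drawing := by
  obtain ⟨f, hf, -, hr, u, v, huv, h0, h1⟩ := Φ.arc_path ⟨s(a, b), h⟩
  refine Set.mem_iUnion.2 ⟨⟨s(a, b), h⟩, ?_⟩
  rw [← hr]
  rcases Sym2.eq_iff.1 huv with ⟨rfl, rfl⟩ | ⟨rfl, rfl⟩
  · exact ⟨0, h0⟩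
  · exact ⟨1, h1⟩

/-- A vertex on the frontier of a face can be joined into the face without touching parts
of the drawing away from the vertex. -/
theorem joined_to_face [Finite V] {F : Set (ℝ × ℝ)} {x : V} (hx : Φ.OnFace F x) :
    ∃ T : Set (ℝ × ℝ), (∃ p ∈ F, JoinedIn T (Φ.vmap x) p) ∧
      ∀ Y : Set V, x ∉ Y → Disjoint T (Φ.region Y) := by
  have hopen : IsOpen (Φ.region {x}ᶜ)ᶜ := (Φ.isClosed_region _).isOpen_compl
  have hmem : Φ.vmap x ∈ (Φ.region {x}ᶜ)ᶜ := by
    rw [Set.mem_compl_iff, vmap_mem_region]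
    simp
  obtain ⟨r, hr, hball⟩ := Metric.isOpen_iff.1 hopen _ hmem
  obtain ⟨p, hpF, hpd⟩ := Metric.mem_closure_iff.1 (frontier_subset_closure hx) r hr
  refine ⟨Metric.ball (Φ.vmap x) r, ⟨p, hpF, ?_⟩, ?_⟩
  · refine JoinedIn.of_segment_subset ?_
    refine (convex_ball _ _).segment_subset (Metric.mem_ball_self hr) ?_
    rw [Metric.mem_ball, dist_comm]
    exact hpd
  · intro Y hY
    refine Set.disjoint_left.2 fun q hq hqY => hball hq ?_
    rcases Φ.mem_region.1 hqY with ⟨v, hv, rfl⟩ | ⟨e, he, hq⟩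
    · exact Φ.vmap_mem_region.2 (fun h => hY (h ▸ hv))
    · exact Φ.mem_region.2 (Or.inr ⟨e, fun v hv h => hY (h ▸ he v hv), hq⟩)

theorem face_link [Finite V] (hcov : ∀ v, Φ.vmap v ∈ Φ.drawing) {F : Set (ℝ × ℝ)}
    (hF : Φ.IsFace F) {c k x : V} {K : Set V} (hk : k ∈ K)
    (hK : JoinedIn (Φ.region K) (Φ.vmap c) (Φ.vmap k))
    (hkF : Φ.OnFace F k) (hxF : Φ.OnFace F x) :
    ∃ T : Set (ℝ × ℝ), JoinedIn T (Φ.vmap c) (Φ.vmap x) ∧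
      ∀ Y : Set V, x ∉ Y → Disjoint K Y → Disjoint T (Φ.region Y) := by
  obtain ⟨T1, ⟨p1, hp1, hj1⟩, hd1⟩ := Φ.joined_to_face hkF
  obtain ⟨T2, ⟨p2, hp2, hj2⟩, hd2⟩ := Φ.joined_to_face hxF
  obtain ⟨p, hp, rfl⟩ := hF
  have hopen : IsOpen (connectedComponentIn Φ.drawingᶜ p) :=
    Φ.isClosed_drawing.isOpen_compl.connectedComponentIn
  have hconn : IsConnected (connectedComponentIn Φ.drawingᶜ p) :=
    isConnected_connectedComponentIn_iff.2 hp
  have hpc := hopen.isConnected_iff_isPathConnected.1 hconn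
  have hjF := hpc.joinedIn p1 hp1 p2 hp2
  refine ⟨Φ.region K ∪ T1 ∪ connectedComponentIn Φ.drawingᶜ p ∪ T2, ?_, ?_⟩
  · refine (hK.mono ?_).trans ((hj1.mono ?_).trans ((hjF.mono ?_).trans (hj2.symm.mono ?_))) <;>
    · intro q hq
      simp [hq]
  · intro Y hY hKY
    simp only [Set.disjoint_union_left]
    refine ⟨⟨⟨Φ.region_disjoint hKY, hd1 Y ?_⟩, ?_⟩, hd2 Y hY⟩
    · exact Set.disjoint_left.1 hKY hk
    · refine Set.disjoint_left.2 fun q hq hqY => ?_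
      exact connectedComponentIn_subset _ _ hq (Φ.region_subset_drawing hcov _ hqY)

theorem core [Finite V] (hcov : ∀ v, Φ.vmap v ∈ Φ.drawing) {A B x x' w c : V} {XA XB K : Set V}
    (hAx : G.Adj A x) (hAx' : G.Adj A x') (hBx : G.Adj B x) (hBx' : G.Adj B x') (hcw : G.Adj c w)
    (hXA : JoinedIn (Φ.region XA) (Φ.vmap A) (Φ.vmap w))
    (hXB : JoinedIn (Φ.region XB) (Φ.vmap B) (Φ.vmap w))
    (hAB : A ≠ B) (hxx : x ≠ x') (hAw : A ≠ w) (hBw : B ≠ w) (hxw : x ≠ w) (hxw' : x' ≠ w)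
    (hA : A ∉ XB) (hB : B ∉ XA) (hxA : x ∉ XA) (hxA' : x' ∉ XA) (hxB : x ∉ XB) (hxB' : x' ∉ XB)
    (hKA : Disjoint K XA) (hKB : Disjoint K XB) (hAK : A ∉ K) (hBK : B ∉ K) (hxK : x ∉ K)
    (hxK' : x' ∉ K) (hcK : c ∈ K) {k k' : V} (hk : k ∈ K) (hk' : k' ∈ K)
    (hck : JoinedIn (Φ.region K) (Φ.vmap c) (Φ.vmap k))
    (hck' : JoinedIn (Φ.region K) (Φ.vmap c) (Φ.vmap k'))
    {F F' : Set (ℝ × ℝ)} (hF : Φ.IsFace F) (hF' : Φ.IsFace F') (hkF : Φ.OnFace F k)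
    (hxF : Φ.OnFace F x) (hkF' : Φ.OnFace F' k') (hxF' : Φ.OnFace F' x') : False := by
  obtain ⟨T, hT, hTd⟩ := Φ.face_link hcov hF hk hck hkF hxF
  obtain ⟨T', hT', hTd'⟩ := Φ.face_link hcov hF' hk' hck' hkF' hxF'
  have ne {p q : V} {S : Set V} (h1 : p ∈ S) (h2 : q ∉ S) : p ≠ q := fun h => h2 (h ▸ h1)
  have hcA := ne hcK hAK
  have hcB := ne hcK hBK
  have hcx := ne hcK hxK
  have hcx' := ne hcK hxK'
  have pd {p q r s : V} (h1 : p ≠ r) (h2 : p ≠ s) (h3 : q ≠ r) (h4 : q ≠ s) :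
      Disjoint (Φ.region {p, q}) (Φ.region {r, s}) := by
    apply Φ.region_disjoint
    simp [h1.symm, h2.symm, h3.symm, h4.symm]
  have sd {p q : V} {S : Set V} (h1 : p ∉ S) (h2 : q ∉ S) :
      Disjoint (Φ.region {p, q}) (Φ.region S) := by
    apply Φ.region_disjoint
    simp [h1, h2]
  have e1 : Disjoint (Φ.region {A, x}) (Φ.region {B, x'}) := pd hAB hAx'.ne hBx.ne' hxx
  have e2 : Disjoint (Φ.region {A, x}) (Φ.region XB) := sd hA hxB
  have hcAX : c ∉ XA := Set.disjoint_left.1 hKA hcK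
  have hcBX : c ∉ XB := Set.disjoint_left.1 hKB hcK
  have e3 : Disjoint T' (Φ.region {A, x}) :=
    hTd' _ (by simp [hAx'.ne', hxx.symm]) (by simp [hAK, hxK])
  have e4 : Disjoint (Φ.region {A, x}) (Φ.region {c, w}) := pd hcA.symm hAw hcx.symm hxw
  have f1 : Disjoint (Φ.region {A, x'}) (Φ.region {B, x}) := pd hAB hAx.ne hBx'.ne' hxx.symm
  have f2 : Disjoint (Φ.region {A, x'}) (Φ.region XB) := sd hA hxB'
  have f3 : Disjoint T (Φ.region {A, x'}) :=
    hTd _ (by simp [hAx.ne', hxx]) (by simp [hAK, hxK'])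
  have f4 : Disjoint (Φ.region {A, x'}) (Φ.region {c, w}) := pd hcA.symm hAw hcx'.symm hxw'
  have g1 : Disjoint (Φ.region {B, x}) (Φ.region XA) := sd hB hxA
  have g2 : Disjoint (Φ.region {B, x'}) (Φ.region XA) := sd hB hxA'
  have g3 : Disjoint T (Φ.region XA) := hTd _ hxA hKA
  have g4 : Disjoint T' (Φ.region XA) := hTd' _ hxA' hKA
  have g5 : Disjoint T (Φ.region XB) := hTd _ hxB hKB
  have g6 : Disjoint T' (Φ.region XB) := hTd' _ hxB' hKB
  have i1 : Disjoint T' (Φ.region {B, x}) :=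
    hTd' _ (by simp [hBx'.ne', hxx.symm]) (by simp [hBK, hxK])
  have i2 : Disjoint T (Φ.region {B, x'}) :=
    hTd _ (by simp [hBx.ne', hxx]) (by simp [hBK, hxK'])
  have i3 : Disjoint (Φ.region {B, x}) (Φ.region {c, w}) := pd hcB.symm hBw hcx.symm hxw
  have i4 : Disjoint (Φ.region {B, x'}) (Φ.region {c, w}) := pd hcB.symm hBw hcx'.symm hxw'
  have adj {p q : V} (h : G.Adj p q) : JoinedIn (Φ.region {p, q}) (Φ.vmap p) (Φ.vmap q) :=
    Φ.joined_of_adj h (by simp) (by simp)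
  refine PlaneK33.k33_sets ![Φ.vmap A, Φ.vmap B, Φ.vmap c] ![Φ.vmap x, Φ.vmap x', Φ.vmap w]
    ![![Φ.region {A, x}, Φ.region {A, x'}, Φ.region XA],
      ![Φ.region {B, x}, Φ.region {B, x'}, Φ.region XB],
      ![T, T', Φ.region {c, w}]] ?_ ?_
  · have := adj hAx
    have := adj hAx'
    have := adj hBx
    have := adj hBx'
    have := adj hcw
    intro i j
    fin_cases i <;> fin_cases j <;> assumption
  · intro i j i' j' hi hj
    fin_cases i <;> fin_cases i' <;> first | exact absurd rfl hi | skip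
    all_goals
      clear hi
      fin_cases j <;> fin_cases j' <;> first | exact absurd rfl hj | skip
    all_goals
      clear hj
      first | assumption | (apply Disjoint.symm; assumption)

end region

end PlaneEmbedding

section cnf
variable {n m : ℕ}

instance : Finite (CNFVtx n m) := by
  refine Finite.of_injective (β := (Fin n × Bool) ⊕ Fin m ⊕ Fin (n + 1))
    (fun v => match v with
      | .lit i b => .inl (i, b)
      | .cl j => .inr (.inl j)
      | .u k => .inr (.inr k)) ?_
  rintro (_ | _ | _) (_ | _ | _) h <;> simp_all

theorem adj_of_rel {a b : CNFVtx n m} (h : cnfRel n m a b) (hne : a ≠ b) :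
    (cnfGraph n m).Adj a b := by
  rw [cnfGraph, SimpleGraph.fromRel_adj]
  exact ⟨hne, Or.inl h⟩

theorem adj_u_lit (i : Fin n) (p : Bool) :
    (cnfGraph n m).Adj (.u i.castSucc) (.lit i p) :=
  adj_of_rel (Or.inl ⟨i, p, rfl, rfl⟩) (by simp)

theorem adj_lit_u (i : Fin n) (p : Bool) :
    (cnfGraph n m).Adj (.lit i p) (.u i.succ) :=
  adj_of_rel (Or.inr (Or.inl ⟨i, p, rfl, rfl⟩)) (by simp)

theorem adj_u_cl (j : Fin m) (hj : (j : ℕ) = 0) : (cnfGraph n m).Adj (.cl j) (.u 0) :=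
  (adj_of_rel (Or.inr (Or.inr (Or.inl ⟨j, hj, rfl, rfl⟩))) (by simp)).symm

theorem adj_cl_cl (j j' : Fin m) (hj : (j' : ℕ) = j + 1) :
    (cnfGraph n m).Adj (.cl j) (.cl j') :=
  adj_of_rel (Or.inr (Or.inr (Or.inr (Or.inl ⟨j, j', hj, rfl, rfl⟩)))) (by
    intro h
    have := congrArg Fin.val (CNFVtx.cl.inj h)
    omega)

theorem adj_cl_u (j : Fin m) (hj : (j : ℕ) + 1 = m) :
    (cnfGraph n m).Adj (.cl j) (.u (Fin.last n)) :=
  adj_of_rel (Or.inr (Or.inr (Or.inr (Or.inr (Or.inl ⟨j, hj, rfl, rfl⟩))))) (by simp)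

theorem adj_u_u (hn : 2 ≤ n) : (cnfGraph n m).Adj (.u (Fin.last n)) (.u 0) :=
  adj_of_rel (Or.inr (Or.inr (Or.inr (Or.inr (Or.inr ⟨rfl, rfl⟩))))) (by
    intro h
    have := congrArg Fin.val (CNFVtx.u.inj h)
    simp at this
    omega)

theorem exists_adj (v : CNFVtx n m) (hn : 2 ≤ n) : ∃ w, (cnfGraph n m).Adj v w := by
  rcases v with ⟨i, p⟩ | j | k
  · exact ⟨_, adj_lit_u i p⟩
  · by_cases hj : (j : ℕ) + 1 = m
    · exact ⟨_, adj_cl_u j hj⟩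
    · exact ⟨_, adj_cl_cl j ⟨j + 1, by omega⟩ rfl⟩
  · induction k using Fin.lastCases with
    | last => exact ⟨_, adj_u_u hn⟩
    | cast i => exact ⟨_, adj_u_lit i true⟩

theorem joined_u (Φ : PlaneEmbedding (cnfGraph n m)) (X : Set (CNFVtx n m)) (lo hi : ℕ)
    (hlo : lo ≤ hi) (hhi : hi < n + 1)
    (hu : ∀ k : Fin (n + 1), lo ≤ k → (k : ℕ) ≤ hi → CNFVtx.u k ∈ X)
    (hl : ∀ k : Fin n, lo ≤ k → (k : ℕ) < hi → CNFVtx.lit k true ∈ X) :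
    JoinedIn (Φ.region X) (Φ.vmap (.u ⟨lo, by omega⟩)) (Φ.vmap (.u ⟨hi, hhi⟩)) := by
  induction hi, hlo using Nat.le_induction with
  | base =>
    exact JoinedIn.refl (Φ.vmap_mem_region.2 (hu _ le_rfl le_rfl))
  | succ k hk ih =>
    refine (ih (by omega) (fun k' h h' => hu k' h (by omega))
      (fun k' h h' => hl k' h (by omega))).trans ?_
    have h1 := hl ⟨k, by omega⟩ hk (by simp)
    exact (Φ.joined_of_adj (adj_u_lit ⟨k, by omega⟩ true) (hu _ hk (by simp)) h1).trans
      (Φ.joined_of_adj (adj_lit_u ⟨k, by omega⟩ true) h1 (hu _ (by simp; omega) (by simp)))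

theorem joined_cl (Φ : PlaneEmbedding (cnfGraph n m)) (j j' : Fin m) :
    JoinedIn (Φ.region (Set.range CNFVtx.cl)) (Φ.vmap (.cl j)) (Φ.vmap (.cl j')) := by
  have key : ∀ (k : ℕ) (hk : k < m), JoinedIn (Φ.region (Set.range CNFVtx.cl))
      (Φ.vmap (.cl ⟨0, by omega⟩)) (Φ.vmap (.cl ⟨k, hk⟩)) := by
    intro k
    induction k with
    | zero => exact fun hk => JoinedIn.refl (Φ.vmap_mem_region.2 ⟨_, rfl⟩)
    | succ k ih =>
      intro hk
      exact (ih (by omega)).trans (Φ.joined_of_adj (adj_cl_cl _ _ rfl) ⟨_, rfl⟩ ⟨_, rfl⟩)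
  exact (key j j.2).symm.trans (key j' j'.2)

theorem no_conflict (hn : 2 ≤ n) (hm : 1 ≤ m) (Φ : PlaneEmbedding (cnfGraph n m)) (i : Fin n)
    (j j' : Fin m) (F F' : Set (ℝ × ℝ)) (hF : Φ.IsFace F) (hF' : Φ.IsFace F')
    (hj : Φ.OnFace F (.cl j)) (hj' : Φ.OnFace F' (.cl j'))
    (hx : Φ.OnFace F (.lit i true)) (hx' : Φ.OnFace F' (.lit i false)) : False := by
  have hcov : ∀ v, Φ.vmap v ∈ Φ.drawing := fun v => by
    obtain ⟨w, hw⟩ := exists_adj v hn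
    exact Φ.vmap_mem_drawing hw
  by_cases hi : (i : ℕ) = 0
  · refine Φ.core hcov (A := .u i.castSucc) (B := .u i.succ) (x := .lit i true)
      (x' := .lit i false) (w := .u (Fin.last n)) (c := .cl ⟨m - 1, by omega⟩)
      (XA := {.u 0, .u (Fin.last n)})
      (XB := {v | (∃ k : Fin (n + 1), 1 ≤ (k : ℕ) ∧ v = .u k) ∨
        (∃ (k : Fin n) (p : Bool), 1 ≤ (k : ℕ) ∧ v = .lit k p)})
      (K := Set.range CNFVtx.cl)
      (adj_u_lit i _) (adj_u_lit i _) (adj_lit_u i _).symm (adj_lit_u i _).symm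
      (adj_cl_u _ (by simp; omega)) ?_ ?_ ?_ ?_ ?_ ?_ ?_ ?_ ?_ ?_ ?_ ?_ ?_ ?_ ?_ ?_ ?_ ?_ ?_ ?_ ?_
      ⟨_, rfl⟩ ⟨_, rfl⟩ (joined_cl Φ _ _) (joined_cl Φ _ _) hF hF' hj hx hj' hx'
    · have h0 : i.castSucc = 0 := Fin.ext hi
      rw [h0]
      exact Φ.joined_of_adj (adj_u_u hn).symm (by simp) (by simp)
    · have := joined_u Φ {v | (∃ k : Fin (n + 1), 1 ≤ (k : ℕ) ∧ v = .u k) ∨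
        (∃ (k : Fin n) (p : Bool), 1 ≤ (k : ℕ) ∧ v = .lit k p)} 1 n (by omega) (by omega)
        (fun k h _ => Or.inl ⟨k, h, rfl⟩) (fun k h _ => Or.inr ⟨k, _, h, rfl⟩)
      have h1 : i.succ = ⟨1, by omega⟩ := Fin.ext (by simp [hi])
      rw [h1]
      exact this
    all_goals first
      | (rw [Set.disjoint_left]; rintro _ ⟨j, rfl⟩; simp; done)
      | (simp; done)
      | (intro h; have := congrArg Fin.val (CNFVtx.u.inj h); simp at this <;> omega)
      | (simp only [Set.mem_ofPred_eq, Set.mem_insert_iff, Set.mem_singleton_iff, not_or,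
          CNFVtx.u.injEq, CNFVtx.lit.injEq, reduceCtorEq, Fin.ext_iff, not_exists, not_and,
          Fin.val_castSucc, Fin.val_succ, Fin.val_last, Fin.val_zero]
         grind)
  · refine Φ.core hcov (A := .u i.castSucc) (B := .u i.succ) (x := .lit i true)
      (x' := .lit i false) (w := .u 0) (c := .cl ⟨0, by omega⟩)
      (XA := {v | (∃ k : Fin (n + 1), (k : ℕ) ≤ i ∧ v = .u k) ∨
        (∃ (k : Fin n) (p : Bool), (k : ℕ) < i ∧ v = .lit k p)})
      (XB := {v | (∃ k : Fin (n + 1), ((k : ℕ) = 0 ∨ (i : ℕ) < k) ∧ v = .u k) ∨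
        (∃ (k : Fin n) (p : Bool), (i : ℕ) < (k : ℕ) ∧ v = .lit k p)})
      (K := Set.range CNFVtx.cl)
      (adj_u_lit i _) (adj_u_lit i _) (adj_lit_u i _).symm (adj_lit_u i _).symm
      (adj_u_cl _ rfl) ?_ ?_ ?_ ?_ ?_ ?_ ?_ ?_ ?_ ?_ ?_ ?_ ?_ ?_ ?_ ?_ ?_ ?_ ?_ ?_ ?_
      ⟨_, rfl⟩ ⟨_, rfl⟩ (joined_cl Φ _ _) (joined_cl Φ _ _) hF hF' hj hx hj' hx'
    · have := joined_u Φ {v | (∃ k : Fin (n + 1), (k : ℕ) ≤ i ∧ v = .u k) ∨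
        (∃ (k : Fin n) (p : Bool), (k : ℕ) < i ∧ v = .lit k p)} 0 i (by omega) (by omega)
        (fun k _ h => Or.inl ⟨k, h, rfl⟩) (fun k _ h => Or.inr ⟨k, _, h, rfl⟩)
      exact this.symm
    · have h1 := joined_u Φ {v | (∃ k : Fin (n + 1), ((k : ℕ) = 0 ∨ (i : ℕ) < k) ∧ v = .u k) ∨
        (∃ (k : Fin n) (p : Bool), (i : ℕ) < (k : ℕ) ∧ v = .lit k p)} (i + 1) n (by omega)
        (by omega)
        (fun k h _ => Or.inl ⟨k, Or.inr h, rfl⟩) (fun k h _ => Or.inr ⟨k, _, h, rfl⟩)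
      exact JoinedIn.trans h1 (Φ.joined_of_adj (adj_u_u hn)
        (Or.inl ⟨_, Or.inr (by simp), rfl⟩) (Or.inl ⟨_, Or.inl rfl, rfl⟩))
    all_goals first
      | (rw [Set.disjoint_left]; rintro _ ⟨j, rfl⟩; simp; done)
      | (simp; done)
      | (intro h; have := congrArg Fin.val (CNFVtx.u.inj h); simp at this <;> omega)
      | (simp only [Set.mem_ofPred_eq, Set.mem_insert_iff, Set.mem_singleton_iff, not_or,
          CNFVtx.u.injEq, CNFVtx.lit.injEq, reduceCtorEq, Fin.ext_iff, not_exists, not_and,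
          Fin.val_castSucc, Fin.val_succ, Fin.val_last, Fin.val_zero]
         grind)

theorem reverse_dir (hn : 2 ≤ n) (hm : 1 ≤ m) (C : Fin m → Finset (Fin n × Bool))
    (Φ : PlaneEmbedding (cnfGraph n m)) (h : ∀ j : Fin m,
        ∃ F : Set (ℝ × ℝ), Φ.IsFace F ∧ Φ.OnFace F (CNFVtx.cl j) ∧
          ∃ l ∈ C j, Φ.OnFace F (CNFVtx.lit l.1 l.2)) :
    ∃ a : Fin n → Bool, ∀ j : Fin m, ∃ l ∈ C j, a l.1 = l.2 := by
  classical
  refine ⟨fun i => decide (∃ (j : Fin m) (F : Set (ℝ × ℝ)), Φ.IsFace F ∧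
    Φ.OnFace F (CNFVtx.cl j) ∧ Φ.OnFace F (CNFVtx.lit i true)), fun j => ?_⟩
  obtain ⟨F, hF, hj, ⟨i, p⟩, hl, hx⟩ := h j
  refine ⟨(i, p), hl, ?_⟩
  cases p with
  | true => simpa using ⟨j, F, hF, hj, hx⟩
  | false =>
    simp only [decide_eq_false_iff_not]
    rintro ⟨j', F', hF', hj', hx'⟩
    exact no_conflict hn hm Φ i j' j F' F hF' hF hj' hj hx' hx

end cnf

namespace CNFDraw

section draw
variable {n m : ℕ}

/-- The upper envelope of the drawing. -/
noncomputable def T (n : ℕ) (x : ℝ) : ℝ := 4 * x * (n - x)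

/-- The upper side of the chain of diamonds. -/
noncomputable def D (x : ℝ) : ℝ := |Real.sin (Real.pi * x)|

/-- The four curves containing all the arcs. -/
noncomputable def hgt (n : ℕ) (l : Fin 4) (x : ℝ) : ℝ :=
  ![T n x, D x, -D x, -T n x] l

/-- The step length on each of the four curves. -/
noncomputable def st (n m : ℕ) (l : Fin 4) : ℝ :=
  ![(n : ℝ) / (m + 1), 1 / 2, 1 / 2, (n : ℝ)] l

theorem D_nonneg (x : ℝ) : 0 ≤ D x := abs_nonneg _

theorem D_lt_T (hn : 2 ≤ n) {x : ℝ} (h0 : 0 < x) (h1 : x < n) : D x < T n x := by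
  have hn' : (2 : ℝ) ≤ n := by exact_mod_cast hn
  have hpi := Real.pi_lt_four
  have hpi0 := Real.pi_pos
  have a1 : D x < 4 * x := by
    have : D x ≤ |Real.pi * x| := Real.abs_sin_le_abs
    rw [abs_of_pos (by positivity)] at this
    nlinarith
  have a2 : D x < 4 * (n - x) := by
    have e : D x = |Real.sin (Real.pi * (n - x))| := by
      have : Real.pi * (n - x) = n * Real.pi - Real.pi * x := by ring
      rw [this, Real.sin_nat_mul_pi_sub, abs_neg, abs_mul]
      simp [D]
    have h : |Real.sin (Real.pi * (n - x))| ≤ |Real.pi * (n - x)| := Real.abs_sin_le_abs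
    have hx : 0 < (n : ℝ) - x := by linarith
    rw [← e, abs_of_pos (mul_pos hpi0 hx)] at h
    nlinarith
  unfold T
  by_cases h : 1 ≤ x
  · nlinarith
  · nlinarith

theorem D_nat (k : ℕ) : D k = 0 := by
  rw [D, mul_comm, Real.sin_nat_mul_pi, abs_zero]

theorem D_half (k : ℕ) : D (k + 1 / 2) = 1 := by
  have : Real.pi * (k + 1 / 2) = k * Real.pi + Real.pi / 2 := by ring
  have h := Real.cos_nat_mul_pi k
  rw [D, this, Real.sin_add_pi_div_two, h, abs_pow]
  simp

theorem D_eq_zero {x : ℝ} (h0 : 0 ≤ x) (h : D x = 0) : ∃ k : ℕ, x = k := by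
  rw [D, abs_eq_zero, Real.sin_eq_zero_iff] at h
  obtain ⟨k, hk⟩ := h
  have hx : x = k := by
    have := Real.pi_pos
    have : Real.pi * (x - k) = 0 := by linarith
    rcases mul_eq_zero.1 this with h | h
    · linarith
    · linarith
  have hk0 : 0 ≤ k := by
    rw [hx] at h0
    exact_mod_cast h0
  lift k to ℕ using hk0
  exact ⟨k, by simpa using hx⟩

theorem hgt_zero (n : ℕ) (l : Fin 4) : hgt n l 0 = 0 := by
  have := D_nat 0
  fin_cases l <;> simp_all [hgt, T]

theorem hgt_n (n : ℕ) (l : Fin 4) : hgt n l n = 0 := by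
  have := D_nat n
  fin_cases l <;> simp_all [hgt, T]

theorem continuous_T (n : ℕ) : Continuous (T n) := by
  unfold T
  fun_prop

theorem continuous_D : Continuous D := by
  unfold D
  fun_prop

theorem continuous_hgt (n : ℕ) (l : Fin 4) : Continuous (hgt n l) := by
  have h1 := continuous_T n
  have h2 := continuous_D
  fin_cases l
  · exact h1
  · exact h2
  · exact h2.neg
  · exact h1.neg

theorem hgt_eq (hn : 2 ≤ n) {l l' : Fin 4} (hl : l ≠ l') {x : ℝ} (h0 : 0 ≤ x) (h1 : x ≤ n)
    (h : hgt n l x = hgt n l' x) : ∃ k : Fin (n + 1), x = (k : ℕ) ∧ hgt n l x = 0 := by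
  rcases h0.eq_or_lt with rfl | h0'
  · exact ⟨0, by simp, hgt_zero n l⟩
  rcases h1.eq_or_lt with rfl | h1'
  · exact ⟨Fin.last n, by simp, hgt_n n l⟩
  have hT := D_lt_T hn h0' h1'
  have hD := D_nonneg x
  have key : D x = 0 ∧ hgt n l x = 0 := by
    fin_cases l <;> fin_cases l' <;> first | exact absurd rfl hl | skip
    all_goals
      simp [hgt] at h ⊢
      first | (exfalso; linarith) | linarith
  obtain ⟨k, rfl⟩ := D_eq_zero h0 key.1
  have hk : k ≤ n := by exact_mod_cast h1
  exact ⟨⟨k, by omega⟩, rfl, key.2⟩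

/-- First coordinate of a vertex. -/
noncomputable def vx : CNFVtx n m → ℝ
  | .lit i _ => (i : ℕ) + 1 / 2
  | .cl j => (n : ℝ) * ((j : ℕ) + 1) / (m + 1)
  | .u k => (k : ℕ)

/-- Second coordinate of a vertex. -/
noncomputable def vy (a : Fin n → Bool) : CNFVtx n m → ℝ
  | .lit i b => if a i = b then 1 else -1
  | .cl j => T n (vx (n := n) (m := m) (.cl j))
  | .u _ => 0

theorem cl_bounds (hn : 2 ≤ n) (j : Fin m) :
    0 < vx (n := n) (.cl j) ∧ vx (n := n) (.cl j) < n := by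
  have hn' : (2 : ℝ) ≤ n := by exact_mod_cast hn
  have hj : ((j : ℕ) : ℝ) + 1 ≤ m := by exact_mod_cast j.2
  have hj0 : (0 : ℝ) ≤ (j : ℕ) := Nat.cast_nonneg _
  have hm : (0 : ℝ) < m + 1 := by positivity
  constructor
  · unfold vx
    positivity
  · simp only [vx]
    rw [div_lt_iff₀ hm]
    nlinarith

theorem cl_y (hn : 2 ≤ n) (a : Fin n → Bool) (j : Fin m) :
    D (vx (n := n) (.cl j)) < vy a (.cl j) :=
  D_lt_T hn (cl_bounds hn j).1 (cl_bounds hn j).2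

theorem lit_y (a : Fin n → Bool) (i : Fin n) (b : Bool) :
    |vy (m := m) a (.lit i b)| = D (vx (n := n) (m := m) (.lit i b)) := by
  simp only [vy, vx]
  rw [D_half]
  split_ifs <;> simp

theorem u_y (a : Fin n → Bool) (k : Fin (n + 1)) :
    |vy (m := m) a (.u k)| = D (vx (n := n) (m := m) (.u k)) := by
  simp only [vy, vx]
  rw [D_nat]
  simp

theorem half_ne (k i : ℕ) : (k : ℝ) ≠ i + 1 / 2 := by
  intro h
  have : (2 * k : ℝ) = 2 * i + 1 := by linarith
  have : 2 * k = 2 * i + 1 := by exact_mod_cast this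
  omega

theorem pos_inj (hn : 2 ≤ n) (a : Fin n → Bool) {v w : CNFVtx n m} (hx : vx v = vx w)
    (hy : vy a v = vy a w) : v = w := by
  have hm : (m : ℝ) + 1 ≠ 0 := by positivity
  have hn' : (n : ℝ) ≠ 0 := by
    have : n ≠ 0 := by omega
    exact_mod_cast this
  rcases v with ⟨i, b⟩ | j | k <;> rcases w with ⟨i', b'⟩ | j' | k'
  · have hi : i = i' := by
      simp only [vx, add_left_inj, Nat.cast_inj] at hx
      exact Fin.ext hx
    subst hi
    simp only [vy] at hy
    have : b = b' := by
      revert hy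
      cases a i <;> cases b <;> cases b' <;> norm_num
    rw [this]
  · have h1 := lit_y (m := m) a i b
    have h2 := cl_y hn a j'
    rw [← hx, ← hy, ← h1] at h2
    exact absurd (le_abs_self _) h2.not_ge
  · exact absurd hx.symm (half_ne _ _)
  · have h1 := lit_y (m := m) a i' b'
    have h2 := cl_y hn a j
    rw [hx, hy, ← h1] at h2
    exact absurd (le_abs_self _) h2.not_ge
  · have : j = j' := by
      simp only [vx] at hx
      field_simp at hx
      have := add_right_cancel hx
      exact Fin.ext (by exact_mod_cast this)
    rw [this]
  · have h1 := u_y (m := m) a k'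
    have h2 := cl_y hn a j
    rw [hx, hy, ← h1] at h2
    exact absurd (le_abs_self _) h2.not_ge
  · exact absurd hx (half_ne _ _)
  · have h1 := u_y (m := m) a k
    have h2 := cl_y hn a j'
    rw [← hx, ← hy, ← h1] at h2
    exact absurd (le_abs_self _) h2.not_ge
  · simp only [vx, Nat.cast_inj] at hx
    rw [Fin.ext hx]

theorem T_nat (hx : T n x = 0) : x = 0 ∨ x = n := by
  rcases mul_eq_zero.1 hx with h | h
  · left
    linarith
  · right
    linarith

/-- A vertex lying on one of the four curves is at a breakpoint of that curve. -/
theorem breakpoint (hn : 2 ≤ n) (a : Fin n → Bool) (v : CNFVtx n m) (l : Fin 4)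
    (h : vy a v = hgt n l (vx v)) : ∃ k : ℕ, vx v = k * st n m l := by
  have hm : (m : ℝ) + 1 ≠ 0 := by positivity
  rcases v with ⟨i, b⟩ | j | k
  · have h1 := lit_y (m := m) a i b
    have hlt : D (vx (n := n) (m := m) (.lit i b)) < T n (vx (n := n) (m := m) (.lit i b)) := by
      have hi : ((i : ℕ) : ℝ) + 1 ≤ n := by exact_mod_cast i.2
      have hi0 : (0 : ℝ) ≤ (i : ℕ) := Nat.cast_nonneg _
      apply D_lt_T hn <;> simp only [vx] <;> linarith
    have h2 := abs_le.1 h1.le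
    have hb : ∃ k : ℕ, vx (n := n) (m := m) (.lit i b) = k * (1 / 2 : ℝ) :=
      ⟨2 * i + 1, by simp only [vx]; push_cast; ring⟩
    fin_cases l
    · simp [hgt] at h
      linarith
    · simpa [st] using hb
    · simpa [st] using hb
    · simp [hgt] at h
      linarith
  · have h1 := cl_y hn a j
    have h2 := D_nonneg (vx (n := n) (.cl j))
    fin_cases l
    · exact ⟨j + 1, by simp [vx, st]; ring⟩
    · simp [hgt] at h
      linarith
    · simp [hgt] at h
      linarith
    · simp [hgt] at h
      have : vy a (.cl j) = T n (vx (n := n) (.cl j)) := rfl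
      linarith
  · have hb : ∃ k' : ℕ, vx (n := n) (m := m) (.u k) = k' * (1 / 2 : ℝ) :=
      ⟨2 * k, by simp only [vx]; push_cast; ring⟩
    have hT : T n (vx (n := n) (m := m) (.u k)) = 0 →
        vx (n := n) (m := m) (.u k) = 0 ∨ vx (n := n) (m := m) (.u k) = n := T_nat
    fin_cases l
    · simp [hgt] at h
      rcases hT h.symm with h | h
      · exact ⟨0, by simp [h]⟩
      · refine ⟨m + 1, ?_⟩
        rw [h]
        simp [st]
        field_simp
    · simpa [st] using hb
    · simpa [st] using hb
    · simp [hgt] at h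
      rcases hT (by simpa [vy] using h) with h | h
      · exact ⟨0, by simp [h]⟩
      · exact ⟨1, by simp [h, st]⟩

/-- Edges oriented left to right, with the curve and the index of the interval. -/
inductive OE (a : Fin n → Bool) : CNFVtx n m → CNFVtx n m → Fin 4 → ℕ → Prop
  | ul (i : Fin n) (b : Bool) :
      OE a (.u i.castSucc) (.lit i b) (if a i = b then 1 else 2) (2 * i)
  | lu (i : Fin n) (b : Bool) :
      OE a (.lit i b) (.u i.succ) (if a i = b then 1 else 2) (2 * i + 1)
  | uc (j : Fin m) (hj : (j : ℕ) = 0) : OE a (.u 0) (.cl j) 0 0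
  | cc (j j' : Fin m) (hj : (j' : ℕ) = j + 1) : OE a (.cl j) (.cl j') 0 (j + 1)
  | cu (j : Fin m) (hj : (j : ℕ) + 1 = m) : OE a (.cl j) (.u (Fin.last n)) 0 (j + 1)
  | uu : OE a (.u 0) (.u (Fin.last n)) 3 0

theorem exists_OE (a : Fin n → Bool) (e : Sym2 (CNFVtx n m)) (he : e ∈ (cnfGraph n m).edgeSet) :
    ∃ p q l k, OE a p q l k ∧ e = s(p, q) := by
  have key : ∀ p q : CNFVtx n m, cnfRel n m p q → ∃ p' q' l k, OE a p' q' l k ∧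
      s(p, q) = s(p', q') := by
    rintro p q (⟨i, b, rfl, rfl⟩ | ⟨i, b, rfl, rfl⟩ | ⟨j, hj, rfl, rfl⟩ | ⟨j, j', hj, rfl, rfl⟩ |
      ⟨j, hj, rfl, rfl⟩ | ⟨rfl, rfl⟩)
    · exact ⟨_, _, _, _, .ul i b, rfl⟩
    · exact ⟨_, _, _, _, .lu i b, rfl⟩
    · exact ⟨_, _, _, _, .uc j hj, rfl⟩
    · exact ⟨_, _, _, _, .cc j j' hj, rfl⟩
    · exact ⟨_, _, _, _, .cu j hj, rfl⟩
    · exact ⟨_, _, _, _, .uu, Sym2.eq_swap⟩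
  induction e using Sym2.ind with
  | _ p q =>
    rw [SimpleGraph.mem_edgeSet, cnfGraph, SimpleGraph.fromRel_adj] at he
    rcases he.2 with h | h
    · exact key _ _ h
    · rw [Sym2.eq_swap]
      exact key _ _ h

theorem OE_left {a : Fin n → Bool} {p q : CNFVtx n m} {l k} (h : OE a p q l k) :
    vx p = k * st n m l ∧ vy a p = hgt n l (vx p) := by
  have h0 := hgt_zero n
  cases h with
  | ul i b =>
    have := D_nat i
    split_ifs <;> simp [vx, vy, st, hgt, this] <;> ring
  | lu i b =>
    have := D_half i
    split_ifs with h <;> (simp only [vx, vy, st, hgt, h]; simp; constructor)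
    any_goals (norm_num at this ⊢; linarith)
  | uc j hj => simp [vx, vy, st, h0]
  | cc j j' hj => simp [vx, vy, st, hgt]; ring
  | cu j hj => simp [vx, vy, st, hgt]; ring
  | uu => simp [vx, vy, st, h0]

theorem OE_right {a : Fin n → Bool} {p q : CNFVtx n m} {l k} (h : OE a p q l k) :
    vx q = (k + 1) * st n m l ∧ vy a q = hgt n l (vx q) := by
  have h1 := hgt_n n
  have hm : (m : ℝ) + 1 ≠ 0 := by positivity
  cases h with
  | ul i b =>
    have := D_half i
    split_ifs with h <;> (simp only [vx, vy, st, hgt, h]; simp; constructor)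
    any_goals (norm_num at this ⊢; linarith)
  | lu i b =>
    have := D_nat (i + 1)
    push_cast at this
    split_ifs <;> simp [vx, vy, st, hgt, this] <;> ring
  | uc j hj => simp [vx, vy, st, hgt, hj]
  | cc j j' hj => simp [vx, vy, st, hgt, hj]; ring
  | cu j hj =>
    have : ((j : ℕ) : ℝ) + 1 = m := by exact_mod_cast hj
    simp [vx, vy, st, h1, this]
    field_simp
  | uu => simp [vx, vy, st, h1]

theorem OE_unique (hn : 2 ≤ n) {a : Fin n → Bool} {p q p' q' : CNFVtx n m} {l k}
    (h : OE a p q l k) (h' : OE a p' q' l k) : p = p' ∧ q = q' := by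
  have h1 := OE_left h
  have h2 := OE_left h'
  have h3 := OE_right h
  have h4 := OE_right h'
  have e1 : vx p = vx p' := h1.1.trans h2.1.symm
  have e2 : vx q = vx q' := h3.1.trans h4.1.symm
  exact ⟨pos_inj hn a e1 (by rw [h1.2, h2.2, e1]), pos_inj hn a e2 (by rw [h3.2, h4.2, e2])⟩

theorem vx_bounds (hn : 2 ≤ n) (v : CNFVtx n m) : 0 ≤ vx v ∧ vx v ≤ n := by
  rcases v with ⟨i, b⟩ | j | k
  · have hi : ((i : ℕ) : ℝ) + 1 ≤ n := by exact_mod_cast i.2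
    have hi0 : (0 : ℝ) ≤ (i : ℕ) := Nat.cast_nonneg _
    simp only [vx]
    constructor <;> linarith
  · exact ⟨(cl_bounds hn j).1.le, (cl_bounds hn j).2.le⟩
  · have hk : (k : ℕ) ≤ n := by omega
    exact ⟨Nat.cast_nonneg _, by simp only [vx]; exact_mod_cast hk⟩

theorem st_pos (hn : 2 ≤ n) (l : Fin 4) : 0 < st n m l := by
  have : (0 : ℝ) < n := by
    have : 0 < n := by omega
    exact_mod_cast this
  fin_cases l <;> simp [st] <;> positivity

/-- The arc of an oriented edge. -/
def garc (n : ℕ) {m : ℕ} (p q : CNFVtx n m) (l : Fin 4) : Set (ℝ × ℝ) :=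
  {z | vx p ≤ z.1 ∧ z.1 ≤ vx q ∧ z.2 = hgt n l z.1}

theorem garc_vertex (hn : 2 ≤ n) {a : Fin n → Bool} {p q v : CNFVtx n m} {l k}
    (h : OE a p q l k) (hv : (vx v, vy a v) ∈ garc n p q l) : v ∈ s(p, q) := by
  obtain ⟨h1, h2, h3⟩ := hv
  dsimp only at h1 h2 h3
  obtain ⟨k', hk'⟩ := breakpoint hn a v l h3
  have hs := st_pos (n := n) (m := m) hn l
  obtain ⟨l1, l2⟩ := OE_left h
  obtain ⟨r1, r2⟩ := OE_right h
  rw [l1, hk'] at h1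
  rw [r1, hk'] at h2
  have g1 : (k : ℝ) ≤ k' := le_of_mul_le_mul_right h1 hs
  have g2 : (k' : ℝ) ≤ k + 1 := le_of_mul_le_mul_right h2 hs
  have g1' : k ≤ k' := by exact_mod_cast g1
  have g2' : k' ≤ k + 1 := by exact_mod_cast g2
  rw [Sym2.mem_iff]
  have : k' = k ∨ k' = k + 1 := by omega
  rcases this with rfl | rfl
  · left
    have e : vx v = vx p := by rw [hk', l1]
    exact pos_inj hn a e (by rw [h3, l2, e])
  · right
    have e : vx v = vx q := by rw [hk', r1]; push_cast; ring
    exact pos_inj hn a e (by rw [h3, r2, e])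

theorem garc_inter (hn : 2 ≤ n) {a : Fin n → Bool} {p q p' q' : CNFVtx n m} {l l' k k'}
    (h : OE a p q l k) (h' : OE a p' q' l' k') (hne : s(p, q) ≠ s(p', q')) {z : ℝ × ℝ}
    (hz : z ∈ garc n p q l) (hz' : z ∈ garc n p' q' l') :
    ∃ v : CNFVtx n m, (vx v, vy a v) = z := by
  obtain ⟨x, y⟩ := z
  obtain ⟨h1, h2, h3⟩ := hz
  obtain ⟨h1', h2', h3'⟩ := hz'
  dsimp only at h1 h2 h3 h1' h2' h3'
  by_cases hl : l = l'
  · subst hl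
    have hk : k ≠ k' := by
      rintro rfl
      obtain ⟨rfl, rfl⟩ := OE_unique hn h h'
      exact hne rfl
    have hs := st_pos (n := n) (m := m) hn l
    obtain ⟨l1, l2⟩ := OE_left h
    obtain ⟨r1, r2⟩ := OE_right h
    obtain ⟨l1', l2'⟩ := OE_left h'
    obtain ⟨r1', r2'⟩ := OE_right h'
    rcases lt_or_gt_of_ne hk with hk | hk
    · have : (k : ℝ) + 1 ≤ k' := by exact_mod_cast hk
      have e : vx q = x := by nlinarith
      refine ⟨q, ?_⟩
      rw [r2, e, h3]
    · have : (k' : ℝ) + 1 ≤ k := by exact_mod_cast hk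
      have e : vx p = x := by nlinarith
      refine ⟨p, ?_⟩
      rw [l2, e, h3]
  · obtain ⟨κ, hκ, h0⟩ := hgt_eq hn hl ((vx_bounds hn p).1.trans h1)
      (h2.trans (vx_bounds hn q).2) (h3.symm.trans h3')
    exact ⟨.u κ, Prod.ext hκ.symm (by rw [h3, h0]; rfl)⟩

theorem garc_path (hn : 2 ≤ n) {a : Fin n → Bool} {p q : CNFVtx n m} {l k} (h : OE a p q l k) :
    ∃ f : unitInterval → ℝ × ℝ, Continuous f ∧ Function.Injective f ∧
      Set.range f = garc n p q l ∧ f 0 = (vx p, vy a p) ∧ f 1 = (vx q, vy a q) := by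
  have hs := st_pos (n := n) (m := m) hn l
  obtain ⟨l1, l2⟩ := OE_left h
  obtain ⟨r1, r2⟩ := OE_right h
  have hlt : vx p < vx q := by
    rw [l1, r1]
    nlinarith
  have hc := continuous_hgt n l
  refine ⟨fun t => (vx p + t * (vx q - vx p), hgt n l (vx p + t * (vx q - vx p))), ?_, ?_, ?_,
    ?_, ?_⟩
  · fun_prop
  · intro s t hst
    have := congrArg Prod.fst hst
    dsimp only at this
    have h2 := mul_right_cancel₀ (sub_pos.2 hlt).ne' (add_left_cancel this)
    exact Subtype.ext h2
  · ext ⟨x, y⟩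
    constructor
    · rintro ⟨t, ht⟩
      obtain ⟨rfl, rfl⟩ := Prod.mk.inj ht
      have t0 := t.2.1
      have t1 := t.2.2
      refine ⟨?_, ?_, rfl⟩ <;> dsimp only <;> nlinarith
    · rintro ⟨h1, h2, h3⟩
      dsimp only at h1 h2 h3
      have hd := sub_pos.2 hlt
      have e : vx p + (x - vx p) / (vx q - vx p) * (vx q - vx p) = x := by
        field_simp
        ring
      refine ⟨⟨(x - vx p) / (vx q - vx p), ?_, ?_⟩, ?_⟩
      · exact div_nonneg (by linarith) hd.le
      · rw [div_le_one hd]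
        linarith
      · dsimp only
        rw [e, h3]
  · simp [l2]
  · simp [r2]

/-- The embedding determined by a truth assignment. -/
theorem exists_embedding (hn : 2 ≤ n) (a : Fin n → Bool) :
    ∃ Φ : PlaneEmbedding (cnfGraph n m), (∀ v, Φ.vmap v = (vx v, vy a v)) ∧
      ∀ z ∈ Φ.drawing, ∃ l, z.2 = hgt n l z.1 := by
  have hex := fun e : (cnfGraph n m).edgeSet => exists_OE a e.1 e.2
  choose P Q L K hO hE using hex
  refine ⟨⟨fun v => (vx v, vy a v), ?_, fun e => garc n (P e) (Q e) (L e), ?_, ?_, ?_⟩,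
    fun v => rfl, ?_⟩
  · intro v w h
    obtain ⟨h1, h2⟩ := Prod.mk.inj h
    exact pos_inj hn a h1 h2
  · intro e
    obtain ⟨f, h1, h2, h3, h4, h5⟩ := garc_path hn (hO e)
    exact ⟨f, h1, h2, h3, P e, Q e, hE e, h4, h5⟩
  · rintro e e' hne z ⟨hz, hz'⟩
    have hne' : s(P e, Q e) ≠ s(P e', Q e') := by
      rw [← hE, ← hE]
      exact fun h => hne (Subtype.ext h)
    obtain ⟨v, rfl⟩ := garc_inter hn (hO e) (hO e') hne' hz hz'
    refine ⟨v, ⟨?_, ?_⟩, rfl⟩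
    · rw [hE]
      exact garc_vertex hn (hO e) hz
    · rw [hE]
      exact garc_vertex hn (hO e') hz'
  · intro e v hv
    rw [hE]
    exact garc_vertex hn (hO e) hv
  · intro z hz
    obtain ⟨e, he⟩ := Set.mem_iUnion.1 hz
    exact ⟨L e, he.2.2⟩

theorem forward_dir (hn : 2 ≤ n) (C : Fin m → Finset (Fin n × Bool))
    (a : Fin n → Bool) (ha : ∀ j : Fin m, ∃ l ∈ C j, a l.1 = l.2) :
    ∃ Φ : PlaneEmbedding (cnfGraph n m), ∀ j : Fin m,
        ∃ F : Set (ℝ × ℝ), Φ.IsFace F ∧ Φ.OnFace F (CNFVtx.cl j) ∧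
          ∃ l ∈ C j, Φ.OnFace F (CNFVtx.lit l.1 l.2) := by
  obtain ⟨Φ, hv, hd⟩ := exists_embedding (m := m) hn a
  refine ⟨Φ, fun j => ?_⟩
  -- the map onto the region between the clause path and the chain of diamonds
  let g : ℝ × ℝ → ℝ × ℝ := fun w => (w.1, (1 - w.2) * D w.1 + w.2 * T n w.1)
  have hgc : Continuous g := by
    have := continuous_T n
    have := continuous_D
    fun_prop
  let S : Set (ℝ × ℝ) := Set.Ioo 0 (n : ℝ) ×ˢ Set.Ioo 0 1
  have hnpos : (0 : ℝ) < n := by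
    have : 0 < n := by omega
    exact_mod_cast this
  have hSc : IsPreconnected (g '' S) :=
    (isPreconnected_Ioo.prod isPreconnected_Ioo).image _ hgc.continuousOn
  have hSd : g '' S ⊆ Φ.drawingᶜ := by
    rintro _ ⟨⟨x, s⟩, ⟨⟨hx0, hx1⟩, hs0, hs1⟩, rfl⟩ hz
    obtain ⟨l, hl⟩ := hd _ hz
    dsimp only [g] at hl hx0 hx1 hs0 hs1
    have h1 := D_lt_T hn hx0 hx1
    have h2 := D_nonneg x
    fin_cases l <;> simp [hgt] at hl <;> nlinarith
  have hp : g ((n : ℝ) / 2, 1 / 2) ∈ g '' S := by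
    refine ⟨_, ⟨⟨?_, ?_⟩, ?_, ?_⟩, rfl⟩ <;> norm_num <;> linarith
  have hsub := hSc.subset_connectedComponentIn hp hSd
  have hcl : ∀ x s : ℝ, 0 < x → x < n → 0 ≤ s → s ≤ 1 →
      g (x, s) ∈ closure (connectedComponentIn Φ.drawingᶜ (g ((n : ℝ) / 2, 1 / 2))) := by
    intro x s hx0 hx1 hs0 hs1
    refine closure_mono hsub (image_closure_subset_closure_image hgc ⟨(x, s), ?_, rfl⟩)
    rw [closure_prod_eq]
    refine ⟨subset_closure ⟨hx0, hx1⟩, ?_⟩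
    rw [closure_Ioo (by norm_num)]
    exact ⟨hs0, hs1⟩
  have hfr : ∀ v, Φ.vmap v ∈ closure (connectedComponentIn Φ.drawingᶜ (g ((n : ℝ) / 2, 1 / 2))) →
      Φ.OnFace (connectedComponentIn Φ.drawingᶜ (g ((n : ℝ) / 2, 1 / 2))) v := by
    intro v h
    refine ⟨h, fun h' => ?_⟩
    obtain ⟨w, hw⟩ := exists_adj v hn
    exact connectedComponentIn_subset _ _ (interior_subset h') (Φ.vmap_mem_drawing hw)
  refine ⟨connectedComponentIn Φ.drawingᶜ (g ((n : ℝ) / 2, 1 / 2)), ⟨_, hSd hp, rfl⟩, hfr _ ?_, ?_⟩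
  · have := hcl _ 1 (cl_bounds hn j).1 (cl_bounds hn j).2 (by norm_num) (by norm_num)
    rw [hv]
    simpa [g, vy] using this
  · obtain ⟨⟨i, b⟩, hl, hab⟩ := ha j
    refine ⟨(i, b), hl, hfr _ ?_⟩
    have hi : ((i : ℕ) : ℝ) + 1 ≤ n := by exact_mod_cast i.2
    have hi0 : (0 : ℝ) ≤ (i : ℕ) := Nat.cast_nonneg _
    have := hcl ((i : ℕ) + 1 / 2) 0 (by linarith) (by linarith) (by norm_num) (by norm_num)
    simp only [g, D_half] at this
    rw [hv]
    dsimp only at hab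
    simpa [vx, vy, hab] using this

end draw
end CNFDraw

/-- a CNF formula `φ` (with `n ≥ 2` variables and clauses `C j`, each clause a set
of literals `(i, b)` meaning `x_i` if `b = true` and `x̄_i` if `b = false`) is satisfiable iff
`G_φ` has a plane embedding in which, for each clause index `j`, some face has on its boundary
the vertex `c_j` and at least one literal vertex of the clause `C j`. -/
theorem statement0 (n m : ℕ) (hn : 2 ≤ n) (hm : 1 ≤ m)
    (C : Fin m → Finset (Fin n × Bool)) :
    (∃ a : Fin n → Bool, ∀ j : Fin m, ∃ l ∈ C j, a l.1 = l.2) ↔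
      (∃ Φ : PlaneEmbedding (cnfGraph n m), ∀ j : Fin m,
        ∃ F : Set (ℝ × ℝ), Φ.IsFace F ∧ Φ.OnFace F (CNFVtx.cl j) ∧
          ∃ l ∈ C j, Φ.OnFace F (CNFVtx.lit l.1 l.2)) := by
  constructor
  · rintro ⟨a, ha⟩
    exact CNFDraw.forward_dir hn C a ha
  · rintro ⟨Φ, h⟩
    exact reverse_dir hn hm C Φ h
end

section
/- Let φ be a CNF formula over variables x₁,…,x_n with n ≥ 2 and clauses C₁,…,C_m with m ≥ 1. Then the graph G_φ is a simple biconnected planar graph. -/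
open Set Topology

/-- A cut vertex: a vertex whose removal increases the number of connected components. -/
def IsCutVertex {V : Type*} (G : SimpleGraph V) (w : V) : Prop :=
  Nat.card G.ConnectedComponent < Nat.card ((G.induce {v : V | v ≠ w}).ConnectedComponent)

/-- A graph is biconnected if it is connected, has at least two vertices and no cut vertex. -/
def Biconnected {V : Type*} (G : SimpleGraph V) : Prop :=
  G.Connected ∧ 2 ≤ Nat.card V ∧ ∀ w : V, ¬ IsCutVertex G w

/-- A graph is triconnected if it is biconnected, has at least three vertices, and the removal
of any two vertices cannot disconnect it. -/
def Triconnected {V : Type*} (G : SimpleGraph V) : Prop :=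
  Biconnected G ∧ 3 ≤ Nat.card V ∧
    ∀ u v : V, u ≠ v → ((G.induce {x : V | x ≠ u ∧ x ≠ v}).Connected)
namespace CNFAux

/-! ### Biconnectivity -/

/-- Reachability in the graph with the vertex `w` removed. -/
def Rch {V : Type*} (G : SimpleGraph V) (w a b : V) : Prop :=
  ∃ (ha : a ∈ {v : V | v ≠ w}) (hb : b ∈ {v : V | v ≠ w}),
    (G.induce {v : V | v ≠ w}).Reachable ⟨a, ha⟩ ⟨b, hb⟩

theorem Rch.refl {V : Type*} {G : SimpleGraph V} {w a : V} (h : a ≠ w) : Rch G w a a :=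
  ⟨h, h, SimpleGraph.Reachable.refl _⟩

theorem Rch.symm {V : Type*} {G : SimpleGraph V} {w a b : V} (h : Rch G w a b) : Rch G w b a := by
  obtain ⟨ha, hb, h⟩ := h
  exact ⟨hb, ha, h.symm⟩

theorem Rch.trans {V : Type*} {G : SimpleGraph V} {w a b c : V} (h : Rch G w a b)
    (h' : Rch G w b c) : Rch G w a c := by
  obtain ⟨ha, hb, h⟩ := h
  obtain ⟨hb', hc, h'⟩ := h'
  exact ⟨ha, hc, h.trans h'⟩

theorem Rch.adj {V : Type*} {G : SimpleGraph V} {w a b : V} (h : G.Adj a b) (ha : a ≠ w)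
    (hb : b ≠ w) : Rch G w a b :=
  ⟨ha, hb, SimpleGraph.Adj.reachable (by simpa using h)⟩

theorem adj_left {n m : ℕ} (i : ℕ) (h : i < n) (p : Bool) :
    (cnfGraph n m).Adj (.u ⟨i, by omega⟩) (.lit ⟨i, h⟩ p) := by
  rw [cnfGraph, SimpleGraph.fromRel_adj]
  exact ⟨by simp, Or.inl (Or.inl ⟨⟨i, h⟩, p, rfl, rfl⟩)⟩

theorem adj_right {n m : ℕ} (i : ℕ) (h : i < n) (p : Bool) :
    (cnfGraph n m).Adj (.lit ⟨i, h⟩ p) (.u ⟨i + 1, by omega⟩) := by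
  rw [cnfGraph, SimpleGraph.fromRel_adj]
  exact ⟨by simp, Or.inl (Or.inr (Or.inl ⟨⟨i, h⟩, p, rfl, rfl⟩))⟩

theorem adj_first {n m : ℕ} (h : 0 < m) :
    (cnfGraph n m).Adj (.u ⟨0, by omega⟩) (.cl ⟨0, h⟩) := by
  rw [cnfGraph, SimpleGraph.fromRel_adj]
  exact ⟨by simp, Or.inl (Or.inr (Or.inr (Or.inl ⟨⟨0, h⟩, rfl, rfl, rfl⟩)))⟩

theorem adj_cl {n m : ℕ} (j : ℕ) (h : j + 1 < m) :
    (cnfGraph n m).Adj (.cl ⟨j, by omega⟩) (.cl ⟨j + 1, h⟩) := by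
  rw [cnfGraph, SimpleGraph.fromRel_adj]
  exact ⟨by simp, Or.inl (Or.inr (Or.inr (Or.inr (Or.inl ⟨⟨j, by omega⟩, ⟨j + 1, h⟩, rfl, rfl, rfl⟩))))⟩

theorem adj_last {n m : ℕ} (j : ℕ) (h : j < m) (hj : j + 1 = m) :
    (cnfGraph n m).Adj (.cl ⟨j, h⟩) (.u ⟨n, by omega⟩) := by
  rw [cnfGraph, SimpleGraph.fromRel_adj]
  exact ⟨by simp, Or.inl (Or.inr (Or.inr (Or.inr (Or.inr (Or.inl ⟨⟨j, h⟩, hj, rfl, rfl⟩)))))⟩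

theorem adj_back {n m : ℕ} (h : 0 < n) :
    (cnfGraph n m).Adj (.u ⟨n, by omega⟩) (.u ⟨0, by omega⟩) := by
  rw [cnfGraph, SimpleGraph.fromRel_adj]
  exact ⟨by simp; omega, Or.inl (Or.inr (Or.inr (Or.inr (Or.inr (Or.inr ⟨rfl, rfl⟩)))))⟩

theorem chain_u {n m : ℕ} (w : CNFVtx n m) (a b : ℕ) (hab : a ≤ b) (hb : b < n + 1)
    (h1 : ∀ t (ht : t < n + 1), a ≤ t → t ≤ b → CNFVtx.u ⟨t, ht⟩ ≠ w)
    (h2 : ∀ t (ht : t < n), a ≤ t → t < b → ∃ p, CNFVtx.lit ⟨t, ht⟩ p ≠ w) :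
    Rch (cnfGraph n m) w (.u ⟨a, by omega⟩) (.u ⟨b, hb⟩) := by
  induction b, hab using Nat.le_induction with
  | base => exact Rch.refl (h1 a _ le_rfl le_rfl)
  | succ k hk ih =>
    have := ih (by omega) (fun t ht h h' => h1 t ht h (by omega))
      (fun t ht h h' => h2 t ht h (by omega))
    obtain ⟨p, hp⟩ := h2 k (by omega) hk (by omega)
    exact (this.trans (Rch.adj (adj_left k (by omega) p) (h1 k _ hk (by omega)) hp)).trans
      (Rch.adj (adj_right k (by omega) p) hp (h1 (k + 1) _ (by omega) le_rfl))

theorem chain_cl {n m : ℕ} (w : CNFVtx n m) (a b : ℕ) (hab : a ≤ b) (hb : b < m)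
    (h1 : ∀ t (ht : t < m), a ≤ t → t ≤ b → CNFVtx.cl ⟨t, ht⟩ ≠ w) :
    Rch (cnfGraph n m) w (.cl ⟨a, by omega⟩) (.cl ⟨b, hb⟩) := by
  induction b, hab using Nat.le_induction with
  | base => exact Rch.refl (h1 a _ le_rfl le_rfl)
  | succ k hk ih =>
    have := ih (by omega) (fun t ht h h' => h1 t ht h (by omega))
    exact this.trans (Rch.adj (adj_cl k (by omega)) (h1 k _ hk (by omega))
      (h1 (k + 1) _ (by omega) le_rfl))

/-- from a clause vertex to one of the poles -/
theorem cl_first {n m : ℕ} (w : CNFVtx n m) (k : ℕ) (hk : k < m)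
    (h0 : CNFVtx.u ⟨0, by omega⟩ ≠ w)
    (h1 : ∀ t (ht : t < m), t ≤ k → CNFVtx.cl ⟨t, ht⟩ ≠ w) :
    Rch (cnfGraph n m) w (.cl ⟨k, hk⟩) (.u ⟨0, by omega⟩) :=
  ((Rch.adj (adj_first (by omega)) h0 (h1 0 _ (by omega))).trans
    (chain_cl w 0 k (by omega) hk (fun t ht _ h => h1 t ht h))).symm

theorem cl_last {n m : ℕ} (w : CNFVtx n m) (k : ℕ) (hk : k < m)
    (h0 : CNFVtx.u ⟨n, by omega⟩ ≠ w)
    (h1 : ∀ t (ht : t < m), k ≤ t → CNFVtx.cl ⟨t, ht⟩ ≠ w) :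
    Rch (cnfGraph n m) w (.cl ⟨k, hk⟩) (.u ⟨n, by omega⟩) :=
  (chain_cl w k (m - 1) (by omega) (by omega) (fun t ht h _ => h1 t ht h)).trans
    (Rch.adj (adj_last (m - 1) (by omega) (by omega)) (h1 _ _ (by omega)) h0)

theorem pole {n m : ℕ} (hn : 2 ≤ n) (w v : CNFVtx n m) (hv : v ≠ w) :
    Rch (cnfGraph n m) w v (.u ⟨0, by omega⟩) ∨ Rch (cnfGraph n m) w v (.u ⟨n, by omega⟩) := by
  rcases w with ⟨⟨i, hi⟩, q⟩ | ⟨j, hj⟩ | ⟨i, hi⟩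
  · -- a literal vertex is removed
    have hu : ∀ k (hk : k < n + 1), Rch (cnfGraph n m) (.lit ⟨i, hi⟩ q)
        (.u ⟨k, hk⟩) (.u ⟨0, by omega⟩) := by
      intro k hk
      refine (chain_u _ 0 k (by omega) hk (by simp) ?_).symm
      intro t ht _ _
      exact ⟨!q, by simp⟩
    left
    rcases v with ⟨⟨k, hk⟩, p⟩ | ⟨k, hk⟩ | ⟨k, hk⟩
    · exact (Rch.adj (adj_left k hk p) (by simp) hv).symm.trans (hu k _)
    · exact cl_first _ k hk (by simp) (by simp)
    · exact hu k hk
  · have hu : ∀ k (hk : k < n + 1), Rch (cnfGraph n m) (.cl ⟨j, hj⟩)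
        (.u ⟨k, hk⟩) (.u ⟨0, by omega⟩) := by
      intro k hk
      refine (chain_u _ 0 k (by omega) hk (by simp) ?_).symm
      intro t ht _ _
      exact ⟨true, by simp⟩
    rcases v with ⟨⟨k, hk⟩, p⟩ | ⟨k, hk⟩ | ⟨k, hk⟩
    · exact Or.inl ((Rch.adj (adj_left k hk p) (by simp) hv).symm.trans (hu k _))
    · have hkj : k ≠ j := by simpa using hv
      rcases lt_or_gt_of_ne hkj with h | h
      · exact Or.inl (cl_first _ k hk (by simp) (by simp; omega))
      · exact Or.inr (cl_last _ k hk (by simp) (by simp; omega))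
    · exact Or.inl (hu k hk)
  · have hl : ∀ k (hk : k < n + 1), k < i → Rch (cnfGraph n m) (.u ⟨i, hi⟩)
        (.u ⟨k, hk⟩) (.u ⟨0, by omega⟩) := by
      intro k hk hki
      refine (chain_u _ 0 k (by omega) hk (by simp; omega) ?_).symm
      intro t ht _ _
      exact ⟨true, by simp⟩
    have hr : ∀ k (hk : k < n + 1), i < k → Rch (cnfGraph n m) (.u ⟨i, hi⟩)
        (.u ⟨k, hk⟩) (.u ⟨n, by omega⟩) := by
      intro k hk hki
      refine chain_u _ k n (by omega) _ (by simp; omega) ?_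
      intro t ht _ _
      exact ⟨true, by simp⟩
    rcases v with ⟨⟨k, hk⟩, p⟩ | ⟨k, hk⟩ | ⟨k, hk⟩
    · rcases lt_or_ge k i with h | h
      · exact Or.inl ((Rch.adj (adj_left k hk p) (by simp; omega) hv).symm.trans (hl k _ h))
      · exact Or.inr ((Rch.adj (adj_right k hk p) hv (by simp; omega)).trans
          (hr (k + 1) _ (by omega)))
    · rcases Nat.eq_zero_or_pos i with h | h
      · exact Or.inr (cl_last _ k hk (by simp; omega) (by simp))
      · exact Or.inl (cl_first _ k hk (by simp; omega) (by simp))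
    · have hkj : k ≠ i := by simpa using hv
      rcases lt_or_gt_of_ne hkj with h | h
      · exact Or.inl (hl k hk h)
      · exact Or.inr (hr k hk h)

theorem rch_all {n m : ℕ} (hn : 2 ≤ n) (w a b : CNFVtx n m) (ha : a ≠ w) (hb : b ≠ w) :
    Rch (cnfGraph n m) w a b := by
  rcases pole hn w a ha with h | h <;> rcases pole hn w b hb with h' | h'
  · exact h.trans h'.symm
  · exact (h.trans (Rch.adj (adj_back (by omega)) h'.2.1 h.2.1).symm).trans h'.symm
  · exact (h.trans (Rch.adj (adj_back (by omega)) h.2.1 h'.2.1)).trans h'.symm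
  · exact h.trans h'.symm

instance finite_vtx (n m : ℕ) : Finite (CNFVtx n m) := by
  let f : (Fin n × Bool) ⊕ Fin m ⊕ Fin (n + 1) → CNFVtx n m := fun x =>
    match x with
    | .inl (i, p) => .lit i p
    | .inr (.inl j) => .cl j
    | .inr (.inr i) => .u i
  refine Finite.of_surjective f ?_
  rintro (⟨i, p⟩ | j | i)
  · exact ⟨.inl (i, p), rfl⟩
  · exact ⟨.inr (.inl j), rfl⟩
  · exact ⟨.inr (.inr i), rfl⟩

theorem bicon {n m : ℕ} (hn : 2 ≤ n) : Biconnected (cnfGraph n m) := by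
  have hex : ∀ a b : CNFVtx n m, ∃ w, a ≠ w ∧ b ≠ w := by
    intro a b
    by_contra! h
    have h0 := h (.u ⟨0, by omega⟩)
    have h1 := h (.u ⟨1, by omega⟩)
    have h2 := h (.u ⟨2, by omega⟩)
    by_cases e0 : a = .u ⟨0, by omega⟩
    · subst e0
      have h1 := h1 (by simp)
      have h2 := h2 (by simp)
      rw [h1] at h2
      simp at h2
    · have h0 := h0 e0
      subst h0
      by_cases e1 : a = .u ⟨1, by omega⟩
      · subst e1
        have := h2 (by simp)
        simp at this
      · have := h1 e1
        simp at this
  refine ⟨?_, ?_, ?_⟩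
  · have : Nonempty (CNFVtx n m) := ⟨.u 0⟩
    refine SimpleGraph.Connected.mk ?_
    intro a b
    obtain ⟨w, hw, hw'⟩ := hex a b
    obtain ⟨_, _, h⟩ := rch_all hn w a b hw hw'
    exact h.map (SimpleGraph.Embedding.induce _).toHom
  · have : Nontrivial (CNFVtx n m) := ⟨.u ⟨0, by omega⟩, .u ⟨1, by omega⟩, by simp⟩
    exact Finite.one_lt_card
  · intro w hw
    unfold IsCutVertex at hw
    have hpre : ((cnfGraph n m).induce {v | v ≠ w}).Preconnected := by
      rintro ⟨a, ha⟩ ⟨b, hb⟩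
      obtain ⟨_, _, h⟩ := rch_all hn w a b ha hb
      exact h
    have := hpre.subsingleton_connectedComponent
    have h1 := Finite.card_le_one_iff_subsingleton.2 this
    have : Nonempty (cnfGraph n m).ConnectedComponent :=
      ⟨(cnfGraph n m).connectedComponentMk (.u 0)⟩
    have := Finite.card_pos (α := (cnfGraph n m).ConnectedComponent)
    omega

/-! ### Planarity -/

/-- Names for the edges. -/
inductive EE (n m : ℕ) : Type where
  | left : Fin n → Bool → EE n m
  | right : Fin n → Bool → EE n m
  | cls : Fin (m + 1) → EE n m
  | back : EE n m

/-- Names for the four curves that carry the drawing. -/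
inductive Crv : Type where
  | lit : Bool → Crv
  | top : Crv
  | bot : Crv

/-- relative height of a curve -/
noncomputable def lev : Crv → ℝ → ℝ
  | .lit true, x => Real.sin (Real.pi * x) ^ 2 / 2
  | .lit false, x => - (Real.sin (Real.pi * x) ^ 2 / 2)
  | .top, _ => 1
  | .bot, _ => -1

/-- the function whose graph is the curve -/
noncomputable def crv (n : ℕ) (K : Crv) (x : ℝ) : ℝ := x * (n - x) * lev K x

theorem crv_cont (n : ℕ) (K : Crv) : Continuous (crv n K) := by
  unfold crv
  rcases K with (_ | _) | _ | _ <;> simp only [lev] <;> fun_prop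

theorem sin_nat (i : ℕ) : Real.sin (Real.pi * i) = 0 := by
  rw [mul_comm]; exact Real.sin_nat_mul_pi i

theorem crv_zero (n : ℕ) (K : Crv) : crv n K 0 = 0 := by simp [crv]
theorem crv_n (n : ℕ) (K : Crv) : crv n K n = 0 := by simp [crv]
theorem crv_lit (n : ℕ) (p : Bool) (i : ℕ) : crv n (.lit p) i = 0 := by
  cases p <;> simp [crv, lev, sin_nat]

theorem sin_zero {x : ℝ} (h0 : 0 ≤ x) (h : Real.sin (Real.pi * x) = 0) : ∃ i : ℕ, x = i := by
  rw [Real.sin_eq_zero_iff] at h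
  obtain ⟨z, hz⟩ := h
  have hx : x = z := by
    have := Real.pi_pos.ne'
    apply mul_left_cancel₀ this
    rw [← hz]; ring
  have hz0 : 0 ≤ z := by
    rw [hx] at h0; exact_mod_cast h0
  lift z to ℕ using hz0
  exact ⟨z, by simpa using hx⟩

/-- distinct curves meet only at integer points; the outer ones only at the ends -/
theorem crossing {n : ℕ} {K K' : Crv} {x : ℝ} (h0 : 0 ≤ x) (hn : x ≤ n) (hK : K ≠ K')
    (h : crv n K x = crv n K' x) :
    x = 0 ∨ x = n ∨ ∃ i : ℕ, x = i ∧ ∃ p q, K = .lit p ∧ K' = .lit q := by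
  by_cases hx0 : x = 0
  · exact Or.inl hx0
  by_cases hxn : x = n
  · exact Or.inr (Or.inl hxn)
  right; right
  have hne : x * (n - x) ≠ 0 := mul_ne_zero hx0 (sub_ne_zero.2 (Ne.symm hxn))
  have hl : lev K x = lev K' x := mul_left_cancel₀ hne h
  have h1 := Real.sin_sq_le_one (Real.pi * x)
  have h2 := sq_nonneg (Real.sin (Real.pi * x))
  have key : ∀ p q, K = .lit p → K' = .lit q → Real.sin (Real.pi * x) ^ 2 = 0 →
      ∃ i : ℕ, x = i ∧ ∃ p q, K = .lit p ∧ K' = .lit q := by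
    intro p q hp hq hs
    obtain ⟨i, hi⟩ := sin_zero h0 (pow_eq_zero_iff (two_ne_zero) |>.1 hs)
    exact ⟨i, hi, p, q, hp, hq⟩
  rcases K with (_ | _) | _ | _ <;> rcases K' with (_ | _) | _ | _ <;>
    simp only [lev, ne_eq, not_true_eq_false] at hl hK <;>
    first
      | (exfalso; linarith)
      | exact key _ _ rfl rfl (by linarith)

/-- subdivision of the interval from `0` to `n` in `m + 1` parts -/
noncomputable def T (n m : ℕ) (a : ℕ) : ℝ := (a : ℝ) * n / (m + 1)

theorem T_lt {n m : ℕ} (hn : 0 < n) {a b : ℕ} : T n m a < T n m b ↔ a < b := by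
  unfold T
  have h1 : (0 : ℝ) < m + 1 := by positivity
  have h2 : (0 : ℝ) < n := by exact_mod_cast hn
  rw [div_lt_div_iff_of_pos_right h1, mul_lt_mul_iff_left₀ h2]
  exact_mod_cast Iff.rfl

theorem T_le {n m : ℕ} (hn : 0 < n) {a b : ℕ} : T n m a ≤ T n m b ↔ a ≤ b := by
  rw [← not_lt, T_lt hn, not_lt]

theorem T_zero {n m : ℕ} : T n m 0 = 0 := by simp [T]
theorem T_last {n m : ℕ} : T n m (m + 1) = n := by
  unfold T
  have h1 : (m + 1 : ℝ) ≠ 0 := by positivity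
  push_cast
  field_simp

/-- first coordinate of a vertex -/
noncomputable def X {n m : ℕ} : CNFVtx n m → ℝ
  | .lit i _ => (i : ℕ) + 1 / 2
  | .cl j => T n m (j + 1)
  | .u i => (i : ℕ)

/-- a curve through a vertex -/
def Kv {n m : ℕ} : CNFVtx n m → Crv
  | .lit _ p => .lit p
  | .cl _ => .top
  | .u _ => .lit true

/-- position of a vertex -/
noncomputable def vm {n m : ℕ} (v : CNFVtx n m) : ℝ × ℝ := (X v, crv n (Kv v) (X v))

noncomputable def lo {n m : ℕ} : EE n m → ℝ
  | .left i _ => (i : ℕ)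
  | .right i _ => (i : ℕ) + 1 / 2
  | .cls j => T n m j
  | .back => 0

noncomputable def hi {n m : ℕ} : EE n m → ℝ
  | .left i _ => (i : ℕ) + 1 / 2
  | .right i _ => (i : ℕ) + 1
  | .cls j => T n m (j + 1)
  | .back => n

def KE {n m : ℕ} : EE n m → Crv
  | .left _ p => .lit p
  | .right _ p => .lit p
  | .cls _ => .top
  | .back => .bot

def src {n m : ℕ} : EE n m → CNFVtx n m
  | .left i _ => .u i.castSucc
  | .right i p => .lit i p
  | .cls j => if h : (j : ℕ) = 0 then .u 0 else .cl ⟨j - 1, by omega⟩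
  | .back => .u 0

def tgt {n m : ℕ} : EE n m → CNFVtx n m
  | .left i p => .lit i p
  | .right i _ => .u i.succ
  | .cls j => if h : (j : ℕ) = m then .u (Fin.last n) else .cl ⟨j, by omega⟩
  | .back => .u (Fin.last n)

theorem vm_u {n m : ℕ} (i : Fin (n + 1)) : vm (.u i : CNFVtx n m) = (((i : ℕ) : ℝ), 0) := by
  simp [vm, X, Kv, crv_lit]

theorem src_pt {n m : ℕ} (E : EE n m) : vm (src E) = (lo E, crv n (KE E) (lo E)) := by
  rcases E with ⟨i, p⟩ | ⟨i, p⟩ | j | _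
  · simp only [src, vm_u, lo, KE, crv_lit]; rfl
  · rfl
  · by_cases h : (j : ℕ) = 0
    · simp [src, h, vm_u, lo, KE, T_zero, crv_zero]
    · have : (j : ℕ) - 1 + 1 = j := by omega
      simp [src, h, vm, X, Kv, lo, KE, this]
  · simp [src, vm_u, lo, KE, crv_zero]

theorem tgt_pt {n m : ℕ} (E : EE n m) : vm (tgt E) = (hi E, crv n (KE E) (hi E)) := by
  rcases E with ⟨i, p⟩ | ⟨i, p⟩ | j | _
  · rfl
  · have := crv_lit n p (i + 1)
    push_cast at this
    simp [tgt, vm_u, hi, KE, this]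
  · by_cases h : (j : ℕ) = m
    · simp [tgt, h, vm_u, hi, KE, T_last, crv_n]
    · simp [tgt, h, vm, X, Kv, hi, KE]
  · simp [tgt, vm_u, hi, KE, crv_n]

theorem lo_lt_hi {n m : ℕ} (hn : 0 < n) (E : EE n m) : lo E < hi E := by
  rcases E with ⟨i, p⟩ | ⟨i, p⟩ | j | _
  · simp [lo, hi]
  · simp only [lo, hi]; linarith
  · simp only [lo, hi]; rw [T_lt hn]; omega
  · simpa [lo, hi] using hn

theorem lo_nonneg {n m : ℕ} (E : EE n m) : 0 ≤ lo E := by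
  rcases E with ⟨i, p⟩ | ⟨i, p⟩ | j | _ <;> simp only [lo, T] <;> positivity

theorem hi_le {n m : ℕ} (hn : 0 < n) (E : EE n m) : hi E ≤ n := by
  have key : ∀ i : Fin n, ((i : ℕ) : ℝ) + 1 ≤ n := fun i => by exact_mod_cast i.2
  rcases E with ⟨i, p⟩ | ⟨i, p⟩ | j | _
  · have := key i
    simp only [hi]; linarith
  · exact key i
  · simp only [hi]; rw [← T_last (n := n) (m := m), T_le hn]; omega
  · exact le_rfl

def arcE {n m : ℕ} (E : EE n m) : Set (ℝ × ℝ) :=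
  {P | lo E ≤ P.1 ∧ P.1 ≤ hi E ∧ P.2 = crv n (KE E) P.1}

theorem halfcast {a b c d : ℕ} (h : (a : ℝ) + b / 2 ≤ c + d / 2) : 2 * a + b ≤ 2 * c + d := by
  have : (2 * a + b : ℝ) ≤ 2 * c + d := by linarith
  exact_mod_cast this

theorem meet {n m : ℕ} (hn : 0 < n) (E E' : EE n m) (hE : E ≠ E') (P : ℝ × ℝ)
    (h : P ∈ arcE E) (h' : P ∈ arcE E') : ∃ v : CNFVtx n m, P = vm v := by
  obtain ⟨x, y⟩ := P
  obtain ⟨h1, h2, h3⟩ := h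
  obtain ⟨h1', h2', h3'⟩ := h'
  simp only at h1 h2 h3 h1' h2' h3'
  by_cases hK : KE E = KE E'
  · by_cases e1 : lo E = x
    · exact ⟨src E, by rw [src_pt, e1, h3]⟩
    by_cases e2 : x = hi E
    · exact ⟨tgt E, by rw [tgt_pt, ← e2, h3]⟩
    by_cases e3 : lo E' = x
    · exact ⟨src E', by rw [src_pt, e3, h3']⟩
    by_cases e4 : x = hi E'
    · exact ⟨tgt E', by rw [tgt_pt, ← e4, h3']⟩
    have g1 := (lt_of_le_of_ne h1 e1).trans (lt_of_le_of_ne h2' e4)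
    have g2 := (lt_of_le_of_ne h1' e3).trans (lt_of_le_of_ne h2 e2)
    exfalso
    apply hE
    rcases E with ⟨i, p⟩ | ⟨i, p⟩ | j | _ <;> rcases E' with ⟨i', p'⟩ | ⟨i', p'⟩ | j' | _ <;>
      simp only [KE, Crv.lit.injEq, reduceCtorEq] at hK <;> simp only [lo, hi] at g1 g2
    · have a1 : ((i : ℕ) : ℝ) < (i' : ℕ) + 1 := by linarith
      have a2 : ((i' : ℕ) : ℝ) < (i : ℕ) + 1 := by linarith
      norm_cast at a1 a2
      have : i = i' := by omega
      rw [this, hK]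
    · have a1 : ((i : ℕ) : ℝ) < (i' : ℕ) + 1 := by linarith
      have a2 : ((i' : ℕ) : ℝ) < (i : ℕ) := by linarith
      norm_cast at a1 a2
      omega
    · have a1 : ((i : ℕ) : ℝ) < (i' : ℕ) := by linarith
      have a2 : ((i' : ℕ) : ℝ) < (i : ℕ) + 1 := by linarith
      norm_cast at a1 a2
      omega
    · have a1 : ((i : ℕ) : ℝ) < (i' : ℕ) + 1 := by linarith
      have a2 : ((i' : ℕ) : ℝ) < (i : ℕ) + 1 := by linarith
      norm_cast at a1 a2
      have : i = i' := by omega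
      rw [this, hK]
    · rw [T_lt hn] at g1 g2
      have : j = j' := by omega
      rw [this]
    · rfl
  · have hx0 := (lo_nonneg E).trans h1
    have hxn := h2.trans (hi_le hn E)
    rcases crossing hx0 hxn hK (h3 ▸ h3') with h | h | ⟨i, h, p, q, hp, hq⟩
    · refine ⟨.u 0, ?_⟩
      rw [vm_u, h3, h, crv_zero]; simp
    · refine ⟨.u (Fin.last n), ?_⟩
      rw [vm_u, h3, h, crv_n]; simp
    · have hi' : i ≤ n := by rw [h] at hxn; exact_mod_cast hxn
      refine ⟨.u ⟨i, by omega⟩, ?_⟩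
      rw [vm_u, h3, hp, h, crv_lit]

theorem X_bounds {n m : ℕ} (hn : 0 < n) (v : CNFVtx n m) : 0 ≤ X v ∧ X v ≤ n := by
  rcases v with ⟨i, p⟩ | j | i
  · have : ((i : ℕ) : ℝ) + 1 ≤ n := by exact_mod_cast i.2
    simp only [X]
    exact ⟨by positivity, by linarith⟩
  · simp only [X]
    constructor
    · unfold T; positivity
    · rw [← T_last (n := n) (m := m), T_le hn]; omega
  · simp only [X]
    exact ⟨by positivity, by exact_mod_cast i.is_le⟩

/-- integer points of the literal curves are `u` vertices -/
theorem mem_arc {n m : ℕ} (hn : 0 < n) (E : EE n m) (v : CNFVtx n m) (h : vm v ∈ arcE E) :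
    v = src E ∨ v = tgt E := by
  obtain ⟨h1, h2, h3⟩ := h
  simp only [vm] at h1 h2 h3
  obtain ⟨b0, bn⟩ := X_bounds hn v
  have half : ∀ a b : ℕ, (a : ℝ) + 1 / 2 ≠ b := by
    intro a b hab
    have : (2 * a + 1 : ℝ) = 2 * b := by linarith
    have : 2 * a + 1 = 2 * b := by exact_mod_cast this
    omega
  rcases v with ⟨k, q⟩ | k | k
  · have hK : Kv (.lit k q : CNFVtx n m) = KE E := by
      by_contra hK
      rcases crossing b0 bn hK h3 with h | h | ⟨i, h, -⟩
      · exact half k 0 (by simpa [X] using h)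
      · exact half k n h
      · exact half k i h
    rcases E with ⟨i, p⟩ | ⟨i, p⟩ | j | _ <;>
      simp only [Kv, KE, Crv.lit.injEq, reduceCtorEq] at hK <;> simp only [lo, hi, X] at h1 h2
    · have a1 : ((i : ℕ) : ℝ) < (k : ℕ) + 1 := by linarith
      have a2 : ((k : ℕ) : ℝ) < (i : ℕ) + 1 := by linarith
      norm_cast at a1 a2
      have : k = i := by omega
      right; rw [this, hK]; rfl
    · have a1 : ((i : ℕ) : ℝ) < (k : ℕ) + 1 := by linarith
      have a2 : ((k : ℕ) : ℝ) < (i : ℕ) + 1 := by linarith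
      norm_cast at a1 a2
      have : k = i := by omega
      left; rw [this, hK]; rfl
  · have e0 : X (.cl k : CNFVtx n m) ≠ 0 := by
      simp only [X]
      rw [← T_zero (n := n) (m := m)]
      exact ((T_lt hn).2 (by omega)).ne'
    have en : X (.cl k : CNFVtx n m) ≠ n := by
      simp only [X]
      rw [← T_last (n := n) (m := m)]
      exact ((T_lt hn).2 (by omega)).ne
    have hK : Kv (.cl k : CNFVtx n m) = KE E := by
      by_contra hK
      rcases crossing b0 bn hK h3 with h | h | ⟨i, h, p, q, hp, -⟩
      · exact e0 h
      · exact en h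
      · simp [Kv] at hp
    rcases E with ⟨i, p⟩ | ⟨i, p⟩ | j | _ <;>
      simp only [Kv, KE, reduceCtorEq] at hK
    simp only [lo, hi, X] at h1 h2
    rw [T_le hn] at h1 h2
    rcases Nat.lt_or_ge k j with hkj | hkj
    · left
      have h0 : ¬ (j : ℕ) = 0 := by omega
      simp only [src, h0, dite_false, CNFVtx.cl.injEq]
      ext; simp; omega
    · right
      have h0 : ¬ (j : ℕ) = m := by omega
      simp only [tgt, h0, dite_false, CNFVtx.cl.injEq]
      ext; simp; omega
  · have hy : crv n (Kv (.u k : CNFVtx n m)) (X (.u k : CNFVtx n m)) = 0 := crv_lit n true k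
    have ends : (KE E = .top ∨ KE E = .bot) → (k : ℕ) = 0 ∨ (k : ℕ) = n := by
      intro hK
      have hK' : Kv (.u k : CNFVtx n m) ≠ KE E := by
        rcases hK with hK | hK <;> rw [hK] <;> simp [Kv]
      rcases crossing b0 bn hK' h3 with h | h | ⟨i, h, p, q, -, hq⟩
      · left; simpa [X] using h
      · right; simpa [X] using h
      · rcases hK with hK | hK <;> rw [hK] at hq <;> simp at hq
    rcases E with ⟨i, p⟩ | ⟨i, p⟩ | j | _
    · simp only [lo, hi, X] at h1 h2
      have a2 : ((k : ℕ) : ℝ) < (i : ℕ) + 1 := by linarith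
      norm_cast at h1 a2
      left
      simp only [src, CNFVtx.u.injEq]
      ext; simp; omega
    · simp only [lo, hi, X] at h1 h2
      have a2 : ((i : ℕ) : ℝ) < (k : ℕ) := by linarith
      norm_cast at h2 a2
      right
      simp only [tgt, CNFVtx.u.injEq]
      ext; simp; omega
    · simp only [lo, hi, X] at h1 h2
      rcases ends (Or.inl rfl) with h | h
      · rw [h, Nat.cast_zero, ← T_zero (n := n) (m := m), T_le hn] at h1
        left
        have : (j : ℕ) = 0 := by omega
        simp only [src, this, dite_true, CNFVtx.u.injEq]
        ext; simpa using h
      · rw [h, ← T_last (n := n) (m := m), T_le hn] at h2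
        right
        have : (j : ℕ) = m := by omega
        simp only [tgt, this, dite_true, CNFVtx.u.injEq]
        ext; simpa using h
    · rcases ends (Or.inr rfl) with h | h
      · left
        simp only [src, CNFVtx.u.injEq]
        ext; simpa using h
      · right
        simp only [tgt, CNFVtx.u.injEq]
        ext; simpa using h

theorem vm_inj {n m : ℕ} (hn : 0 < n) : Function.Injective (vm : CNFVtx n m → ℝ × ℝ) := by
  have half : ∀ a b : ℕ, (a : ℝ) + 1 / 2 ≠ b := by
    intro a b hab
    have : (2 * a + 1 : ℝ) = 2 * b := by linarith
    have : 2 * a + 1 = 2 * b := by exact_mod_cast this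
    omega
  have hlu : ∀ (i : Fin n) p k, vm (.lit i p : CNFVtx n m) ≠ vm (.u k : CNFVtx n m) := by
    intro i p k h
    exact half i k (congrArg Prod.fst h)
  have hcl : ∀ (j : Fin m) (v : CNFVtx n m), vm (.cl j : CNFVtx n m) = vm v → v = .cl j := by
    intro j v h
    have e : vm (.cl j : CNFVtx n m) = vm (tgt (.cls j.castSucc : EE n m)) := by
      have h0 : ¬ (j : ℕ) = m := by omega
      simp [tgt, h0]
    have e' : vm (.cl j : CNFVtx n m) = vm (src (.cls j.succ : EE n m)) := by
      simp [src]
    have m1 : vm v ∈ arcE (.cls j.castSucc : EE n m) := by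
      rw [← h, e, tgt_pt]
      exact ⟨(lo_lt_hi hn _).le, le_rfl, rfl⟩
    have hv := congrArg Prod.fst h
    have h0 : ¬ (j : ℕ) = m := by omega
    rcases mem_arc hn _ _ m1 with g | g
    · exfalso
      have g' := congrArg vm g
      rw [src_pt, ← h, e, tgt_pt] at g'
      exact (lo_lt_hi hn (.cls j.castSucc : EE n m)).ne' (congrArg Prod.fst g')
    · simpa [tgt, h0] using g
  intro v v' h
  rcases v with ⟨i, p⟩ | j | i
  · have m1 : vm v' ∈ arcE (.left i p : EE n m) := by
      rw [← h]
      change vm (tgt (.left i p : EE n m)) ∈ _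
      rw [tgt_pt]
      exact ⟨(lo_lt_hi hn _).le, le_rfl, rfl⟩
    rcases mem_arc hn _ _ m1 with g | g
    · rw [g] at h
      exact absurd h (hlu _ _ _)
    · exact g.symm
  · exact (hcl j v' h).symm
  · rcases v' with ⟨i', p'⟩ | j' | i'
    · exact absurd h.symm (hlu _ _ _)
    · exact hcl j' _ h.symm
    · rw [vm_u, vm_u] at h
      have := congrArg Prod.fst h
      simp only [Nat.cast_inj] at this
      congr 1
      ext; exact this

theorem edge_rep {n m : ℕ} (e : (cnfGraph n m).edgeSet) :
    ∃ E : EE n m, (e : Sym2 (CNFVtx n m)) = s(src E, tgt E) := by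
  have key : ∀ a b : CNFVtx n m, cnfRel n m a b → ∃ E : EE n m, s(a, b) = s(src E, tgt E) := by
    rintro a b (⟨i, p, rfl, rfl⟩ | ⟨i, p, rfl, rfl⟩ | ⟨j, hj, rfl, rfl⟩ | ⟨j, j', hj, rfl, rfl⟩ |
      ⟨j, hj, rfl, rfl⟩ | ⟨rfl, rfl⟩)
    · exact ⟨.left i p, rfl⟩
    · exact ⟨.right i p, rfl⟩
    · refine ⟨.cls j.castSucc, ?_⟩
      have h0 : ¬ (j : ℕ) = m := by omega
      have h1 : ¬ 0 = m := by omega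
      have : j = ⟨0, by omega⟩ := by ext; exact hj
      simp [src, tgt, h1, this]
    · refine ⟨.cls j'.castSucc, ?_⟩
      have h0 : ¬ (j' : ℕ) = m := by omega
      have h1 : ¬ (j' : ℕ) = 0 := by omega
      have : (⟨(j' : ℕ) - 1, by omega⟩ : Fin m) = j := by ext; simp; omega
      simp [src, tgt, h0, h1, this]
    · refine ⟨.cls j.succ, ?_⟩
      have h0 : ¬ (j.succ : ℕ) = 0 := by simp
      have h1 : (j.succ : ℕ) = m := by simpa using hj
      simp only [src, tgt, h0, dite_false]
      rw [dif_pos h1]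
      rfl
    · exact ⟨.back, Sym2.eq_swap⟩
  obtain ⟨e, he⟩ := e
  induction e using Sym2.ind with
  | _ a b =>
    rw [SimpleGraph.mem_edgeSet, cnfGraph, SimpleGraph.fromRel_adj] at he
    rcases he.2 with h | h
    · exact key a b h
    · obtain ⟨E, hE⟩ := key b a h
      exact ⟨E, by rw [← hE]; exact Sym2.eq_swap⟩

theorem planar {n m : ℕ} (hn : 0 < n) : Planar (cnfGraph n m) := by
  choose E hE using edge_rep (n := n) (m := m)
  have hmem : ∀ (e : (cnfGraph n m).edgeSet) (x : CNFVtx n m), vm x ∈ arcE (E e) →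
      x ∈ (e : Sym2 (CNFVtx n m)) := by
    intro e x hx
    rw [hE e, Sym2.mem_iff]
    exact mem_arc hn _ _ hx
  refine ⟨⟨vm, vm_inj hn, fun e => arcE (E e), ?_, ?_, hmem⟩⟩
  · intro e
    have hlt := lo_lt_hi hn (E e)
    refine ⟨fun t => (lo (E e) + t * (hi (E e) - lo (E e)),
      crv n (KE (E e)) (lo (E e) + t * (hi (E e) - lo (E e)))), ?_, ?_, ?_, src (E e), tgt (E e),
      hE e, ?_, ?_⟩
    · have := crv_cont n (KE (E e))
      fun_prop
    · intro s t hst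
      have h1 := congrArg Prod.fst hst
      simp only [add_right_inj] at h1
      exact Subtype.ext (mul_right_cancel₀ (sub_ne_zero.2 hlt.ne') h1)
    · ext ⟨x, y⟩
      constructor
      · rintro ⟨t, ht⟩
        have hx := congrArg Prod.fst ht
        have hy := congrArg Prod.snd ht
        simp only at hx hy
        refine ⟨?_, ?_, ?_⟩
        · simp only; rw [← hx]; nlinarith [t.2.1]
        · simp only; rw [← hx]; nlinarith [t.2.2]
        · simp only; rw [← hy, hx]
      · rintro ⟨h1, h2, h3⟩
        simp only at h1 h2 h3
        have hd : 0 < hi (E e) - lo (E e) := sub_pos.2 hlt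
        have hx : lo (E e) + (x - lo (E e)) / (hi (E e) - lo (E e)) * (hi (E e) - lo (E e)) = x := by
          rw [div_mul_cancel₀ _ hd.ne']; ring
        refine ⟨⟨(x - lo (E e)) / (hi (E e) - lo (E e)), ?_, ?_⟩, ?_⟩
        · exact div_nonneg (by linarith) hd.le
        · rw [div_le_one hd]; linarith
        · simp only [hx, h3]
    · rw [src_pt]; simp
    · rw [tgt_pt]; simp
  · intro e e' hne P hP
    have hEE : E e ≠ E e' := by
      intro h
      apply hne
      apply Subtype.ext
      rw [hE e, hE e', h]
    obtain ⟨v, rfl⟩ := meet hn _ _ hEE P hP.1 hP.2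
    exact ⟨v, ⟨hmem e v hP.1, hmem e' v hP.2⟩, rfl⟩

end CNFAux

/-- for any CNF formula with `n ≥ 2` variables and `m ≥ 1` clauses, the
(simple, by construction) graph `G_φ` is planar and biconnected. -/
theorem statement1 (n m : ℕ) (hn : 2 ≤ n) (hm : 1 ≤ m)
    (C : Fin m → Finset (Fin n × Bool)) :
    Planar (cnfGraph n m) ∧ Biconnected (cnfGraph n m) := by
  exact ⟨CNFAux.planar (by omega), CNFAux.bicon hn⟩
end
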